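/- Let k be a field of characteristic 0 containing n distinct n-th roots of unity, where n ≥ 3 is an integer. Let R = k[x,y,z] with maximal homogeneous ideal 𝔪 = (x,y,z), and let I = ( x(y^n − z^n), y(z^n − x^n), z(x^n − y^n) ) ⊆ R. Then for all integers r ≥ 1 and m ≥ 1 one has the containment I^{(r(mn+1))} ⊆ 𝔪^r · (I^{(mn)})^r. -/

import Mathlib

/-- The `n`-th symbolic power of an ideal `I`:
`f ∈ I^{(n)}` iff for every associated prime `P` of `R/I` there is `s ∉ P` with `s*f ∈ I^n`.
(For a prime ideal `I` this is exactly `{f | ∃ s ∉ I, s*f ∈ I^n} = Iⁿ R_I ∩ R`.) -/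
def symbolicPower {R : Type*} [CommRing R] (I : Ideal R) (n : ℕ) : Ideal R where
  carrier := {f | ∀ P ∈ associatedPrimes R (R ⧸ I), ∃ s, s ∉ P ∧ s * f ∈ I ^ n}
  zero_mem' := by
    intro P hP
    exact ⟨1, fun h => hP.1.ne_top ((Ideal.eq_top_iff_one P).mpr h), by simp⟩
  add_mem' := by
    intro a b ha hb P hP
    obtain ⟨s, hs, hsa⟩ := ha P hP
    obtain ⟨t, ht, htb⟩ := hb P hP
    refine ⟨s * t, fun h => ((hP.1.mem_or_mem h).elim hs ht), ?_⟩
    have heq : s * t * (a + b) = t * (s * a) + s * (t * b) := by ring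
    rw [heq]
    exact Ideal.add_mem _ (Ideal.mul_mem_left _ _ hsa) (Ideal.mul_mem_left _ _ htb)
  smul_mem' := by
    intro r a ha P hP
    obtain ⟨s, hs, hsa⟩ := ha P hP
    refine ⟨s, hs, ?_⟩
    have heq : s * (r • a) = r * (s * a) := by rw [smul_eq_mul]; ring
    rw [heq]
    exact Ideal.mul_mem_left _ _ hsa

section FermatArrangement

/-- The inequalities between exponents that define the generators of
`binomialIdeal k n N N N N`. -/
def AdmissibleExponents (n N a b c d e f : ℕ) : Prop :=
  N ≤ d + e + f ∧ N ≤ a + b + n * d ∧ N ≤ b + c + n * e ∧ N ≤ a + c + n * f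

theorem AdmissibleExponents.rotate {n N a b c d e f : ℕ} (h : AdmissibleExponents n N a b c d e f) :
    AdmissibleExponents n N b c a e f d := by
  obtain ⟨h0, h1, h2, h3⟩ := h
  exact ⟨by omega, by omega, by omega, by omega⟩

theorem AdmissibleExponents.swap {n N a b c d e f : ℕ} (h : AdmissibleExponents n N a b c d e f) :
    AdmissibleExponents n N b a c d f e := by
  obtain ⟨h0, h1, h2, h3⟩ := h
  exact ⟨by omega, by omega, by omega, by omega⟩

/-- The exponents decompose as a sum of admissible exponents for `M` and for `N`. -/
def SplittableExponents (n M N a b c d e f : ℕ) : Prop :=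
  ∃ a₁ b₁ c₁ d₁ e₁ f₁ a₂ b₂ c₂ d₂ e₂ f₂ : ℕ, a = a₁ + a₂ ∧ b = b₁ + b₂ ∧ c = c₁ + c₂ ∧
    d = d₁ + d₂ ∧ e = e₁ + e₂ ∧ f = f₁ + f₂ ∧ AdmissibleExponents n M a₁ b₁ c₁ d₁ e₁ f₁ ∧
    AdmissibleExponents n N a₂ b₂ c₂ d₂ e₂ f₂

theorem SplittableExponents.rotate {n M N a b c d e f : ℕ}
    (h : SplittableExponents n M N a b c d e f) : SplittableExponents n M N b c a e f d := by
  obtain ⟨a₁, b₁, c₁, d₁, e₁, f₁, a₂, b₂, c₂, d₂, e₂, f₂, ha, hb, hc, hd, he, hf, h₁, h₂⟩ := h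
  exact ⟨_, _, _, _, _, _, _, _, _, _, _, _, hb, hc, ha, he, hf, hd, h₁.rotate, h₂.rotate⟩

theorem SplittableExponents.swap {n M N a b c d e f : ℕ}
    (h : SplittableExponents n M N a b c d e f) : SplittableExponents n M N b a c d f e := by
  obtain ⟨a₁, b₁, c₁, d₁, e₁, f₁, a₂, b₂, c₂, d₂, e₂, f₂, ha, hb, hc, hd, he, hf, h₁, h₂⟩ := h
  exact ⟨_, _, _, _, _, _, _, _, _, _, _, _, hb, ha, hc, hd, hf, he, h₁.swap, h₂.swap⟩

theorem mul_le_add_mul_of_le_one_or_le {n s S d₁ d₂ : ℕ} (h : n * s + n ≤ S + n * (d₁ + d₂))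
    (hd : d₁ ≤ 1 ∨ s ≤ d₂) : n * s ≤ S + n * d₂ := by
  rcases hd with hd | hd
  · have := Nat.mul_le_mul_left n hd
    rw [mul_add] at h
    omega
  · have := Nat.mul_le_mul_left n hd
    omega

theorem AdmissibleExponents.splittable_of_pos {n s a b c d e f : ℕ} (hn : 3 ≤ n)
    (h : AdmissibleExponents n (n * s + n) a b c d e f) (hd : 1 ≤ d) (he : 1 ≤ e) (hf : 1 ≤ f) :
    SplittableExponents n n (n * s) a b c d e f := by
  obtain ⟨h0, h1, h2, h3⟩ := h
  have hns : 3 * s ≤ n * s := Nat.mul_le_mul_right s hn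
  obtain ⟨d₁, d₂, e₁, e₂, f₁, f₂, rfl, rfl, rfl, hsum, hd, hd', he, he', hf, hf'⟩ :
      ∃ d₁ d₂ e₁ e₂ f₁ f₂ : ℕ, d = d₁ + d₂ ∧ e = e₁ + e₂ ∧ f = f₁ + f₂ ∧ d₁ + e₁ + f₁ = n ∧
      1 ≤ d₁ ∧ (d₁ ≤ 1 ∨ s ≤ d₂) ∧ 1 ≤ e₁ ∧ (e₁ ≤ 1 ∨ s ≤ e₂) ∧ 1 ≤ f₁ ∧
      (f₁ ≤ 1 ∨ s ≤ f₂) := by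
    obtain ⟨d₁, hd₁⟩ : ∃ d₁, d₁ = min (max 1 (d - s)) (n - 2) := ⟨_, rfl⟩
    obtain ⟨e₁, he₁⟩ : ∃ e₁, e₁ = min (max 1 (e - s)) (n - 1 - d₁) := ⟨_, rfl⟩
    exact ⟨d₁, d - d₁, e₁, e - e₁, n - d₁ - e₁, f - (n - d₁ - e₁), by omega, by omega, by omega,
      by omega, by omega, by omega, by omega, by omega, by omega, by omega⟩
  refine ⟨0, 0, 0, d₁, e₁, f₁, a, b, c, d₂, e₂, f₂, by simp, by simp, by simp, rfl, rfl, rfl,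
    ⟨hsum.ge, ?_, ?_, ?_⟩, ⟨by omega, ?_, ?_, ?_⟩⟩
  · simpa using Nat.le_mul_of_pos_right n hd
  · simpa using Nat.le_mul_of_pos_right n he
  · simpa using Nat.le_mul_of_pos_right n hf
  · exact mul_le_add_mul_of_le_one_or_le h1 hd'
  · exact mul_le_add_mul_of_le_one_or_le h2 he'
  · exact mul_le_add_mul_of_le_one_or_le h3 hf'

theorem AdmissibleExponents.splittable_of_le {n s a b c e f : ℕ} (hn : 3 ≤ n)
    (h : AdmissibleExponents n (n * s + n) a b c 0 e f) (hb : n ≤ b) (hf : 1 ≤ f) :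
    SplittableExponents n n (n * s) a b c 0 e f := by
  obtain ⟨h0, h1, h2, h3⟩ := h
  have hns : 3 * s ≤ n * s := Nat.mul_le_mul_right s hn
  obtain ⟨b, rfl⟩ := Nat.exists_eq_add_of_le hb
  obtain ⟨e₁, e₂, f₁, f₂, rfl, rfl, hsum, he', hf, hf'⟩ :
      ∃ e₁ e₂ f₁ f₂ : ℕ, e = e₁ + e₂ ∧ f = f₁ + f₂ ∧ e₁ + f₁ = n ∧
      (e₁ = 0 ∨ s ≤ e₂) ∧ 1 ≤ f₁ ∧ (f₁ ≤ 1 ∨ s ≤ f₂) := by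
    obtain ⟨e₁, he₁⟩ : ∃ e₁, e₁ = min (e - s) (n - 1) := ⟨_, rfl⟩
    exact ⟨e₁, e - e₁, n - e₁, f - (n - e₁), by omega, by omega, by omega, by omega, by omega,
      by omega⟩
  refine ⟨0, n, 0, 0, e₁, f₁, a, b, c, 0, e₂, f₂, by simp, by simp, by simp, rfl, rfl, rfl,
    ⟨by omega, by simp, by simp, ?_⟩, ⟨by omega, by omega, ?_, ?_⟩⟩
  · simpa using Nat.le_mul_of_pos_right n hf
  · rcases he' with rfl | he'
    · rw [zero_add] at h2
      omega
    · have := Nat.mul_le_mul_left n he'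
      omega
  · exact mul_le_add_mul_of_le_one_or_le h3 hf'

theorem AdmissibleExponents.splittable_of_eq_zero {n s a b c f : ℕ} (hn : 3 ≤ n) (hs : 1 ≤ s)
    (h : AdmissibleExponents n (n * s + n) a b c 0 0 f) :
    SplittableExponents n n (n * s) a b c 0 0 f := by
  obtain ⟨h0, h1, h2, h3⟩ := h
  have hns : 3 * s ≤ n * s := Nat.mul_le_mul_right s hn
  have hns' : n ≤ n * s := Nat.le_mul_of_pos_right n hs
  obtain ⟨f, rfl⟩ : ∃ f', f = n + f' := Nat.exists_eq_add_of_le (by omega)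
  have hf : n * s ≤ n * f := Nat.mul_le_mul_left n (by omega)
  have hnn : n ≤ n * n := Nat.le_mul_of_pos_right n (by omega)
  by_cases hb : n ≤ b
  · exact ⟨0, n, 0, 0, 0, n, a, b - n, c, 0, 0, f, by omega, by omega, by omega, rfl, rfl, rfl,
      ⟨by omega, by omega, by omega, by omega⟩, ⟨by omega, by omega, by omega, by omega⟩⟩
  · exact ⟨n, 0, n, 0, 0, n, a - n, b, c - n, 0, 0, f, by omega, by omega, by omega, rfl, rfl, rfl,
      ⟨by omega, by omega, by omega, by omega⟩, ⟨by omega, by omega, by omega, by omega⟩⟩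

theorem AdmissibleExponents.splittable_of_zero {n s a b c e f : ℕ} (hn : 3 ≤ n)
    (h : AdmissibleExponents n (n * s + n) a b c 0 e f) :
    SplittableExponents n n (n * s) a b c 0 e f := by
  rcases Nat.eq_zero_or_pos s with rfl | hs
  · exact ⟨a, b, c, 0, e, f, 0, 0, 0, 0, 0, 0, rfl, rfl, rfl, rfl, rfl, rfl, by simpa using h,
      by simp [AdmissibleExponents]⟩
  rcases Nat.eq_zero_or_pos e with rfl | he
  · exact h.splittable_of_eq_zero hn hs
  rcases Nat.eq_zero_or_pos f with rfl | hf
  · exact (h.swap.splittable_of_eq_zero hn hs).swap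
  by_cases hb : n ≤ b
  · exact h.splittable_of_le hn hb hf
  · have hns' : n ≤ n * s := Nat.le_mul_of_pos_right n hs
    have h1 := h.2.1
    exact (h.swap.splittable_of_le hn (by omega) he).swap

theorem AdmissibleExponents.splittable {n s a b c d e f : ℕ} (hn : 3 ≤ n)
    (h : AdmissibleExponents n (n * s + n) a b c d e f) :
    SplittableExponents n n (n * s) a b c d e f := by
  rcases Nat.eq_zero_or_pos d with rfl | hd
  · exact h.splittable_of_zero hn
  rcases Nat.eq_zero_or_pos e with rfl | he
  · exact (h.rotate.splittable_of_zero hn).rotate.rotate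
  rcases Nat.eq_zero_or_pos f with rfl | hf
  · exact (h.rotate.rotate.splittable_of_zero hn).rotate
  exact h.splittable_of_pos hn hd he hf

open MvPolynomial

theorem Prime.pow_sub_dvd_of_dvd_mul {A : Type*} [CommRing A] [IsDomain A] {p a b : A}
    (hp : Prime p) {s j : ℕ} (ha : ¬ p ^ (j + 1) ∣ a) (h : p ^ s ∣ a * b) : p ^ (s - j) ∣ b := by
  rw [pow_dvd_iff_le_emultiplicity, emultiplicity_mul hp] at h
  rw [pow_dvd_iff_le_emultiplicity, not_le] at ha
  rw [pow_dvd_iff_le_emultiplicity]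
  rcases hb : emultiplicity p b with _ | m
  · exact le_top
  · rcases hc : emultiplicity p a with _ | l
    · rw [hc] at ha; exact absurd ha not_top_lt
    · rw [hb, hc] at h
      rw [hc] at ha
      change (s : ℕ∞) ≤ ((l : ℕ) : ℕ∞) + ((m : ℕ) : ℕ∞) at h
      change ((l : ℕ) : ℕ∞) < ((j + 1 : ℕ) : ℕ∞) at ha
      change ((s - j : ℕ) : ℕ∞) ≤ ((m : ℕ) : ℕ∞)
      norm_cast at *
      omega

theorem homogeneousComponent_mul_of_isHomogeneous {σ k : Type*} [CommRing k]
    {l : MvPolynomial σ k} {e : ℕ} (hl : l.IsHomogeneous e) (g : MvPolynomial σ k) (n : ℕ) :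
    homogeneousComponent n (l * g) =
      if e ≤ n then l * homogeneousComponent (n - e) g else 0 := by
  have key : ∀ i, homogeneousComponent n (l * homogeneousComponent i g) =
      if e + i = n then l * homogeneousComponent i g else 0 := fun i => by
    have := homogeneousComponent_of_mem (m := n) (hl.mul (homogeneousComponent_isHomogeneous i g))
    simpa [eq_comm] using this
  conv_lhs => rw [← sum_homogeneousComponent g, Finset.mul_sum, map_sum]
  simp_rw [key]
  split_ifs with h
  · rw [Finset.sum_eq_single (n - e)]
    · simp [h]
    · intro i _ hi
      rw [if_neg (by omega)]
    · intro hi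
      rw [Finset.mem_range, not_lt] at hi
      rw [homogeneousComponent_eq_zero _ _ (by omega)]
      simp
  · exact Finset.sum_eq_zero fun i _ => if_neg (by omega)

theorem exists_isHomogeneous_of_mul_eq {σ k : Type*} [CommRing k]
    {E l g : MvPolynomial σ k} {d : ℕ} (hE : E.IsHomogeneous d) (hl : l.IsHomogeneous 1)
    (h : E = l * g) (hE0 : E ≠ 0) :
    ∃ d' g', d = d' + 1 ∧ g'.IsHomogeneous d' ∧ E = l * g' := by
  have := homogeneousComponent_mul_of_isHomogeneous hl g d
  rw [← h, homogeneousComponent_eq_self hE] at this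
  split_ifs at this with h1
  · exact ⟨d - 1, _, by omega, homogeneousComponent_isHomogeneous _ _, this⟩
  · exact absurd this hE0

section Univariate

open Polynomial

theorem Polynomial.X_sub_one_pow_dvd_of_X_pow_dvd_comp {k : Type*} [Field k] {n : ℕ}
    (hn : (n : k) ≠ 0) {p : k[X]} {t : ℕ} (h : X ^ t ∣ p.comp ((1 + X) ^ n)) :
    (X - 1) ^ t ∣ p := by
  rcases eq_or_ne p 0 with rfl | hp
  · simp
  obtain ⟨q, hq, hq'⟩ := Polynomial.exists_eq_pow_rootMultiplicity_mul_and_not_dvd p hp 1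
  set j := p.rootMultiplicity 1
  suffices t ≤ j by
    rw [hq]
    exact Dvd.dvd.mul_right (by simpa using pow_dvd_pow _ this) _
  rw [hq, mul_comp, mul_comm] at h
  have h2 : ¬ (X : k[X]) ∣ q.comp ((1 + X) ^ n) := by
    rw [X_dvd_iff, coeff_zero_eq_eval_zero, eval_comp]
    rw [dvd_iff_isRoot] at hq'
    simpa using hq'
  have h3 := prime_X.pow_dvd_of_dvd_mul_left t h2 h
  by_contra! hlt
  have h4 : ¬ (X : k[X]) ^ 2 ∣ ((1 + X) ^ n - 1) := by
    intro hd
    rw [X_pow_dvd_iff] at hd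
    have h5 := hd 1 (by norm_num)
    have h6 : ((1 + X) ^ n - 1 : k[X]).coeff 1 = n := by
      have := coeff_derivative ((1 + X) ^ n - 1 : k[X]) 0
      simp only [Nat.cast_zero, zero_add, mul_one] at this
      rw [← this, coeff_zero_eq_eval_zero]
      simp [derivative_pow]
    exact hn (h6 ▸ h5)
  have h7 : (X : k[X]) ∣ ((1 + X) ^ n - 1) := by
    rw [X_dvd_iff, coeff_zero_eq_eval_zero]; simp
  obtain ⟨r, hr⟩ := h7
  have hr' : ¬ X ∣ r := fun ⟨s, hs⟩ => h4 ⟨s, by rw [hr, hs]; ring⟩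
  have h8 : X ^ (j + 1) ∣ r ^ j * X ^ j := by
    refine (pow_dvd_pow _ hlt).trans (h3.trans ?_)
    simp [hr, mul_pow, mul_comm]
  have h9 := prime_X.pow_dvd_of_dvd_mul_left (j + 1) (fun hd => hr' (prime_X.dvd_of_dvd_pow hd)) h8
  have := (pow_dvd_pow_iff (X_ne_zero) (not_isUnit_X)).1 h9
  omega

theorem Polynomial.mem_span_X_pow_mul_X_sub_one_pow {k : Type*} [Field k] {e : ℕ} {q : k[X]}
    (hq : q.natDegree ≤ e) :
    q ∈ Submodule.span k {p : k[X] | ∃ i j, i + j = e ∧ p = X ^ i * (X - 1) ^ j} := by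
  rw [q.as_sum_range_C_mul_X_pow' (Nat.lt_succ_of_le hq)]
  refine Submodule.sum_mem _ fun i hi => ?_
  rw [C_mul']
  refine Submodule.smul_mem _ _ ?_
  have hi' : i ≤ e := by simpa [Nat.lt_succ_iff] using hi
  have h1 : (X ^ i : k[X]) = X ^ i * (X + (-(X - 1))) ^ (e - i) := by
    rw [show (X + (-(X - 1)) : k[X]) = 1 by ring]; simp
  rw [h1, add_pow, Finset.mul_sum]
  refine Submodule.sum_mem _ fun l hl => ?_
  have hl' : l ≤ e - i := by simpa [Nat.lt_succ_iff] using hl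
  rw [neg_pow, show (X ^ i * (X ^ l * ((-1) ^ (e - i - l) * (X - 1) ^ (e - i - l)) *
      ((e - i).choose l : k[X])) : k[X]) = ((-1) ^ (e - i - l) * ((e - i).choose l : k)) •
        (X ^ (i + l) * (X - 1) ^ (e - i - l)) by
    rw [smul_eq_C_mul]; simp only [map_mul, map_pow, map_neg, map_one, map_natCast]; ring]
  exact Submodule.smul_mem _ _ (Submodule.subset_span ⟨_, _, by omega, rfl⟩)

theorem Polynomial.mem_span_of_pow_dvd {k : Type*} [Field k] {d s t : ℕ} {p : k[X]}
    (hp : p.natDegree ≤ d) (hs : X ^ s ∣ p) (ht : (X - 1) ^ t ∣ p) :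
    p ∈ Submodule.span k
      {p : k[X] | ∃ i j, s ≤ i ∧ t ≤ j ∧ i + j = d ∧ p = X ^ i * (X - 1) ^ j} := by
  rcases eq_or_ne p 0 with rfl | hp0
  · exact zero_mem _
  have hco : IsCoprime (X ^ s : k[X]) ((X - 1) ^ t) :=
    IsCoprime.pow ⟨1, -1, by ring⟩
  obtain ⟨q, rfl⟩ := hco.mul_dvd hs ht
  have hq0 : q ≠ 0 := right_ne_zero_of_mul hp0
  have h1 : (X - 1 : k[X]).natDegree = 1 := by simpa using natDegree_X_sub_C (1 : k)
  have h1' : (X - 1 : k[X]) ≠ 0 := by intro h; simp [h] at h1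
  rw [natDegree_mul (left_ne_zero_of_mul hp0) hq0, natDegree_mul (by simp) (pow_ne_zero _ h1'),
    natDegree_pow, natDegree_pow, h1, natDegree_X] at hp
  have := mem_span_X_pow_mul_X_sub_one_pow (q := q) (e := d - s - t) (by omega)
  have h2 := Submodule.mem_map_of_mem (f := LinearMap.mulLeft k (X ^ s * (X - 1) ^ t : k[X])) this
  rw [Submodule.map_span] at h2
  refine Submodule.span_mono ?_ h2
  rintro _ ⟨_, ⟨i, j, hij, rfl⟩, rfl⟩
  exact ⟨s + i, t + j, by omega, by omega, by omega, by simp; ring⟩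

end Univariate

variable {k : Type*} [Field k]

/-- The substitution `Xᵢ ↦ Xᵢ T ^ wᵢ`. -/
noncomputable def weightHom (w : Fin 3 → ℕ) :
    MvPolynomial (Fin 3) k →ₐ[k] Polynomial (MvPolynomial (Fin 3) k) :=
  aeval fun i => Polynomial.C (X i) * Polynomial.X ^ w i

/-- The substitution `(x, y, z) ↦ (ζ₀ (z + x T), ζ₁ (z + y T), ζ₂ z)`; the power of `T` dividing
the image of a form is its order of vanishing at the point `(ζ₀ : ζ₁ : ζ₂)`. -/
noncomputable def pointHom (ζ : Fin 3 → k) :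
    MvPolynomial (Fin 3) k →ₐ[k] Polynomial (MvPolynomial (Fin 3) k) :=
  aeval fun i => Polynomial.C (C (ζ i)) *
    ![Polynomial.C (X 2) + Polynomial.C (X 0) * Polynomial.X,
      Polynomial.C (X 2) + Polynomial.C (X 1) * Polynomial.X, Polynomial.C (X 2)] i

variable (k) in
/-- The ideal generated by the products of powers of the coordinates and of the binomials
`Xᵢ ^ n - Xⱼ ^ n` that satisfy lower bounds on the order of vanishing at the points with
`x ^ n = y ^ n = z ^ n` and at the three coordinate points. -/
noncomputable def binomialIdeal (n t s₁ s₂ s₃ : ℕ) : Ideal (MvPolynomial (Fin 3) k) :=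
  Ideal.span {p | ∃ a b c d e f : ℕ, t ≤ d + e + f ∧ s₁ ≤ a + b + n * d ∧
    s₂ ≤ b + c + n * e ∧ s₃ ≤ a + c + n * f ∧
    p = X 0 ^ a * X 1 ^ b * X 2 ^ c * (X 0 ^ n - X 1 ^ n) ^ d * (X 1 ^ n - X 2 ^ n) ^ e *
      (X 2 ^ n - X 0 ^ n) ^ f}

theorem coeff_coeff_weightHom (w : Fin 3 → ℕ) (F : MvPolynomial (Fin 3) k) (m : Fin 3 →₀ ℕ)
    (j : ℕ) : ((weightHom w F).coeff j).coeff m = if ∑ i, m i * w i = j then F.coeff m else 0 := by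
  induction F using MvPolynomial.induction_on' with
  | monomial u a =>
    have : weightHom w (monomial u a) =
        Polynomial.C (monomial u a) * Polynomial.X ^ (∑ i, u i * w i) := by
      rw [weightHom, aeval_monomial, monomial_eq, Finsupp.prod_fintype _ _ (by simp),
        Finsupp.prod_fintype _ _ (by simp)]
      simp only [mul_pow, Finset.prod_mul_distrib, ← pow_mul, Finset.prod_pow_eq_pow_sum,
        map_mul, map_prod, map_pow, mul_comm (w _)]
      rw [← mul_assoc]
      rfl
    rw [this, Polynomial.coeff_C_mul, Polynomial.coeff_X_pow]
    by_cases hu : u = m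
    · subst hu
      rcases eq_or_ne (∑ i, u i * w i) j with h | h
      · simp [h]
      · simp [h, h.symm]
    · by_cases h : j = ∑ i, u i * w i <;> simp [h, hu]
  | add p q hp hq =>
    simp only [map_add, Polynomial.coeff_add, coeff_add, hp, hq]
    split_ifs <;> simp

theorem X_pow_dvd_weightHom_iff {w : Fin 3 → ℕ} {F : MvPolynomial (Fin 3) k} {s : ℕ} :
    Polynomial.X ^ s ∣ weightHom w F ↔ ∀ m ∈ F.support, s ≤ ∑ i, m i * w i := by
  rw [Polynomial.X_pow_dvd_iff]
  constructor
  · intro h m hm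
    by_contra! hlt
    have := coeff_coeff_weightHom w F m (∑ i, m i * w i)
    rw [h _ hlt, if_pos rfl, coeff_zero] at this
    exact mem_support_iff.1 hm this.symm
  · intro h j hj
    ext m
    rw [coeff_coeff_weightHom, coeff_zero]
    split_ifs with hm
    · by_contra hc
      have := h m (mem_support_iff.2 hc)
      omega
    · rfl

theorem pointHom_one_expand_X_two (n : ℕ) :
    ¬ Polynomial.X ^ (0 + 1) ∣ pointHom (1 : Fin 3 → k) (expand n (X 2)) := by
  rw [zero_add, pow_one, Polynomial.X_dvd_iff, Polynomial.coeff_zero_eq_eval_zero]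
  simp [pointHom]

theorem not_X_sq_dvd_pointHom_one {n : ℕ} (hn : (n : k) ≠ 0) :
    ¬ Polynomial.X ^ (1 + 1) ∣ pointHom (1 : Fin 3 → k) (expand n (X 0 - X 1)) := by
  intro h
  rw [Polynomial.X_pow_dvd_iff] at h
  have h1 := Polynomial.coeff_derivative (pointHom (1 : Fin 3 → k) (expand n (X 0 - X 1))) 0
  rw [h 1 (by norm_num), zero_mul, Polynomial.coeff_zero_eq_eval_zero] at h1
  simp only [map_sub, pointHom, expand_X, map_pow, aeval_X, Polynomial.eval_sub,
    Polynomial.derivative_pow] at h1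
  simp only [Pi.one_apply, map_one, Matrix.cons_val, one_mul, Polynomial.derivative_add,
    Polynomial.derivative_C, Polynomial.derivative_mul, Polynomial.derivative_X,
    Polynomial.eval_mul, Polynomial.eval_add, Polynomial.eval_pow, Polynomial.eval_C,
    Polynomial.eval_X, mul_zero, add_zero, zero_mul, zero_add, mul_one] at h1
  rw [← mul_sub, mul_eq_zero, mul_eq_zero] at h1
  rcases h1 with (h1 | h1) | h1
  · rw [show (n : MvPolynomial (Fin 3) k) = C (n : k) by simp, C_eq_zero] at h1
    exact hn h1
  · exact pow_ne_zero _ (X_ne_zero _) h1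
  · have := congrArg (MvPolynomial.eval ![1, 0, 0]) h1
    simp at this

theorem X_dvd_pointHom_one_expand {n : ℕ} (i j : Fin 3) :
    Polynomial.X ∣ pointHom (1 : Fin 3 → k) (expand n (X i ^ 1 - X j ^ 1)) := by
  rw [Polynomial.X_dvd_iff, Polynomial.coeff_zero_eq_eval_zero]
  fin_cases i <;> fin_cases j <;> simp [pointHom]

theorem dvd_of_mem_binomialIdeal {n t s₁ s₂ s₃ : ℕ} {F : MvPolynomial (Fin 3) k}
    (hF : F ∈ binomialIdeal k 1 t s₁ s₂ s₃) :
    Polynomial.X ^ t ∣ pointHom (1 : Fin 3 → k) (expand n F) ∧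
    Polynomial.X ^ s₁ ∣ weightHom ![1, 1, 0] F ∧ Polynomial.X ^ s₂ ∣ weightHom ![0, 1, 1] F ∧
    Polynomial.X ^ s₃ ∣ weightHom ![1, 0, 1] F := by
  suffices binomialIdeal k 1 t s₁ s₂ s₃ ≤
      (Ideal.span {Polynomial.X ^ t}).comap ((pointHom (1 : Fin 3 → k)).comp (expand n)) ⊓
      ((Ideal.span {Polynomial.X ^ s₁}).comap (weightHom ![1, 1, 0]) ⊓
      ((Ideal.span {Polynomial.X ^ s₂}).comap (weightHom ![0, 1, 1]) ⊓
      (Ideal.span {Polynomial.X ^ s₃}).comap (weightHom ![1, 0, 1]))) by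
    simpa [Ideal.mem_span_singleton] using this hF
  rw [binomialIdeal, Ideal.span_le]
  rintro _ ⟨a, b, c, d, e, f, h0, h1, h2, h3, rfl⟩
  simp only [SetLike.mem_coe, Submodule.mem_inf, Ideal.mem_comap, Ideal.mem_span_singleton]
  refine ⟨?_, ?_, ?_, ?_⟩
  · refine (pow_dvd_pow _ h0).trans ?_
    simp only [AlgHom.comp_apply, map_mul, map_pow (expand n), map_pow (pointHom _)]
    rw [pow_add, pow_add]
    exact mul_dvd_mul (mul_dvd_mul (Dvd.dvd.mul_left (pow_dvd_pow_of_dvd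
      (by simpa using X_dvd_pointHom_one_expand 0 1) _) _) (pow_dvd_pow_of_dvd
      (by simpa using X_dvd_pointHom_one_expand 1 2) _)) (pow_dvd_pow_of_dvd
      (by simpa using X_dvd_pointHom_one_expand 2 0) _)
  · refine (pow_dvd_pow _ h1).trans ?_
    refine ⟨Polynomial.C (X 0 ^ a * X 1 ^ b * X 2 ^ c * (X 0 - X 1) ^ d) *
      weightHom ![1, 1, 0] ((X 1 ^ 1 - X 2 ^ 1) ^ e * (X 2 ^ 1 - X 0 ^ 1) ^ f), ?_⟩
    simp only [weightHom, map_mul, map_pow, map_sub, aeval_X, Matrix.cons_val]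
    rw [show ((Polynomial.C (X 0) * Polynomial.X ^ 1) ^ 1 -
      (Polynomial.C (X 1) * Polynomial.X ^ 1) ^ 1 : Polynomial (MvPolynomial (Fin 3) k)) =
      (Polynomial.C (X 0) - Polynomial.C (X 1)) * Polynomial.X by ring]
    simp only [mul_pow]
    ring
  · refine (pow_dvd_pow _ h2).trans ?_
    refine ⟨Polynomial.C (X 0 ^ a * X 1 ^ b * X 2 ^ c * (X 1 - X 2) ^ e) *
      weightHom ![0, 1, 1] ((X 0 ^ 1 - X 1 ^ 1) ^ d * (X 2 ^ 1 - X 0 ^ 1) ^ f), ?_⟩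
    simp only [weightHom, map_mul, map_pow, map_sub, aeval_X, Matrix.cons_val]
    rw [show ((Polynomial.C (X 1) * Polynomial.X ^ 1) ^ 1 -
      (Polynomial.C (X 2) * Polynomial.X ^ 1) ^ 1 : Polynomial (MvPolynomial (Fin 3) k)) =
      (Polynomial.C (X 1) - Polynomial.C (X 2)) * Polynomial.X by ring]
    simp only [mul_pow]
    ring
  · refine (pow_dvd_pow _ h3).trans ?_
    refine ⟨Polynomial.C (X 0 ^ a * X 1 ^ b * X 2 ^ c * (X 2 - X 0) ^ f) *
      weightHom ![1, 0, 1] ((X 0 ^ 1 - X 1 ^ 1) ^ d * (X 1 ^ 1 - X 2 ^ 1) ^ e), ?_⟩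
    simp only [weightHom, map_mul, map_pow, map_sub, aeval_X, Matrix.cons_val]
    rw [show ((Polynomial.C (X 2) * Polynomial.X ^ 1) ^ 1 -
      (Polynomial.C (X 0) * Polynomial.X ^ 1) ^ 1 : Polynomial (MvPolynomial (Fin 3) k)) =
      (Polynomial.C (X 2) - Polynomial.C (X 0)) * Polynomial.X by ring]
    simp only [mul_pow]
    ring

theorem X_two_mul_mem_binomialIdeal {n t s₁ s₂ s₃ : ℕ} {F : MvPolynomial (Fin 3) k}
    (hF : F ∈ binomialIdeal k n t s₁ (s₂ - 1) (s₃ - 1)) :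
    X 2 * F ∈ binomialIdeal k n t s₁ s₂ s₃ := by
  refine (Submodule.span_le (p := Submodule.comap
    (LinearMap.mulLeft (MvPolynomial (Fin 3) k) (X 2)) (binomialIdeal k n t s₁ s₂ s₃))).2 ?_ hF
  rintro _ ⟨a, b, c, d, e, f, h0, h1, h2, h3, rfl⟩
  exact Ideal.subset_span ⟨a, b, c + 1, d, e, f, h0, h1, by omega, by omega, by simp; ring⟩

theorem X_zero_sub_X_one_mul_mem_binomialIdeal {t s₁ s₂ s₃ : ℕ} {F : MvPolynomial (Fin 3) k}
    (hF : F ∈ binomialIdeal k 1 (t - 1) (s₁ - 1) s₂ s₃) :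
    (X 0 - X 1) * F ∈ binomialIdeal k 1 t s₁ s₂ s₃ := by
  refine (Submodule.span_le (p := Submodule.comap
    (LinearMap.mulLeft (MvPolynomial (Fin 3) k) (X 0 - X 1)) (binomialIdeal k 1 t s₁ s₂ s₃))).2 ?_ hF
  rintro _ ⟨a, b, c, d, e, f, h0, h1, h2, h3, rfl⟩
  exact Ideal.subset_span ⟨a, b, c, d + 1, e, f, by omega, by omega, h2, h3, by simp; ring⟩

theorem MvPolynomial.IsHomogeneous.sum_eq {d : ℕ} {F : MvPolynomial (Fin 3) k}
    (hF : F.IsHomogeneous d) {m : Fin 3 →₀ ℕ} (hm : m ∈ F.support) : m 0 + m 1 + m 2 = d := by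
  rw [hF.degree_eq_sum_deg_support hm, ← Fin.sum_univ_three,
    Finset.sum_subset (Finset.subset_univ m.support) (by simp)]

theorem X_two_dvd_of_lt {s₂ s₃ d : ℕ} {F : MvPolynomial (Fin 3) k} (hF : F.IsHomogeneous d)
    (h2 : Polynomial.X ^ s₂ ∣ weightHom ![0, 1, 1] F)
    (h3 : Polynomial.X ^ s₃ ∣ weightHom ![1, 0, 1] F) (hd : d < s₂ + s₃) : X 2 ∣ F := by
  rw [X_pow_dvd_weightHom_iff] at h2 h3
  rw [F.as_sum]
  refine Finset.dvd_sum fun m hm => ?_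
  rw [X_dvd_monomial]
  right
  have h2 := h2 m hm
  have h3 := h3 m hm
  have h4 := hF.sum_eq hm
  simp only [Fin.sum_univ_three, Matrix.cons_val] at h2 h3
  omega

theorem exists_eq_X_zero_sub_X_one_mul {d : ℕ} {E : MvPolynomial (Fin 3) k}
    (hE : E.IsHomogeneous d) (h : aeval ![Polynomial.X, Polynomial.X, (1 : Polynomial k)] E = 0) :
    ∃ g, E = (X 0 - X 1) * g := by
  have h1 : aeval ![(X 1 : MvPolynomial (Fin 3) k), X 1, X 2] E = 0 := by
    let H : Polynomial k →ₗ[k] MvPolynomial (Fin 3) k :=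
      (Polynomial.basisMonomials k).constr k fun j => X 1 ^ j * X 2 ^ (d - j)
    have hH : ∀ j, H (Polynomial.X ^ j) = X 1 ^ j * X 2 ^ (d - j) := fun j => by
      have := (Polynomial.basisMonomials k).constr_basis k
        (fun j => (X 1 ^ j * X 2 ^ (d - j) : MvPolynomial (Fin 3) k)) j
      rw [Polynomial.coe_basisMonomials] at this
      beta_reduce at this
      rwa [Polynomial.monomial_one_right_eq_X_pow] at this
    suffices aeval ![(X 1 : MvPolynomial (Fin 3) k), X 1, X 2] E =
        H (aeval ![Polynomial.X, Polynomial.X, (1 : Polynomial k)] E) by rw [this, h, map_zero]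
    rw [E.as_sum, map_sum, map_sum, map_sum]
    refine Finset.sum_congr rfl fun m hm => ?_
    have h4 := hE.sum_eq hm
    rw [aeval_monomial, aeval_monomial, Finsupp.prod_fintype _ _ (by simp),
      Finsupp.prod_fintype _ _ (by simp), ← Algebra.smul_def, ← Algebra.smul_def, map_smul]
    simp only [Fin.prod_univ_three, Matrix.cons_val, one_pow, mul_one, ← pow_add, hH]
    rw [show d - (m 0 + m 1) = m 2 by omega]
  let J : Ideal (MvPolynomial (Fin 3) k) := Ideal.span {X 0 - X 1}
  have h2 : Ideal.Quotient.mkₐ k J =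
      (Ideal.Quotient.mkₐ k J).comp (aeval ![(X 1 : MvPolynomial (Fin 3) k), X 1, X 2]) := by
    ext i
    fin_cases i
    · simpa using (Ideal.Quotient.mk_eq_mk_iff_sub_mem _ _).2
        (Ideal.mem_span_singleton_self (X 0 - X 1 : MvPolynomial (Fin 3) k))
    · simp
    · simp
  have h3 := DFunLike.congr_fun h2 E
  rw [AlgHom.comp_apply, h1, map_zero] at h3
  exact Ideal.mem_span_singleton.1 (Ideal.Quotient.eq_zero_iff_mem.1 h3)

theorem exists_mem_binomialIdeal_aeval_eq {d t s₁ s₂ s₃ : ℕ} (hd : s₂ + s₃ ≤ d)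
    {p : Polynomial k} (hp : p.natDegree ≤ d) (hs : Polynomial.X ^ s₁ ∣ p)
    (ht : (Polynomial.X - 1) ^ t ∣ p) :
    ∃ G ∈ binomialIdeal k 1 t s₁ s₂ s₃, G.IsHomogeneous d ∧
      aeval ![Polynomial.X, Polynomial.X, (1 : Polynomial k)] G = p := by
  have h1 := Polynomial.mem_span_of_pow_dvd hp hs ht
  suffices p ∈ Submodule.map
      (aeval ![Polynomial.X, Polynomial.X, (1 : Polynomial k)] :
        MvPolynomial (Fin 3) k →ₐ[k] Polynomial k).toLinearMap
      ((binomialIdeal k 1 t s₁ s₂ s₃).restrictScalars k ⊓ homogeneousSubmodule (Fin 3) k d) by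
    obtain ⟨G, ⟨hG1, hG2⟩, hG3⟩ := this
    exact ⟨G, hG1, hG2, hG3⟩
  refine Submodule.span_le.2 ?_ h1
  rintro _ ⟨i, j, hi, hj, hij, rfl⟩
  refine ⟨C ((-1) ^ (j - (s₂ - i))) * (X 0 ^ (i - s₂) * X 1 ^ (i - (i - s₂)) * X 2 ^ 0 *
    (X 0 ^ 1 - X 1 ^ 1) ^ 0 * (X 1 ^ 1 - X 2 ^ 1) ^ (s₂ - i) *
    (X 2 ^ 1 - X 0 ^ 1) ^ (j - (s₂ - i))), ⟨?_, ?_⟩, ?_⟩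
  · exact Ideal.mul_mem_left _ _ (Ideal.subset_span ⟨_, _, _, _, _, _, by omega, by omega,
      by omega, by omega, rfl⟩)
  · rw [SetLike.mem_coe, mem_homogeneousSubmodule]
    refine IsHomogeneous.C_mul ?_ _
    have h12 : (X 1 - X 2 : MvPolynomial (Fin 3) k).IsHomogeneous 1 :=
      (isHomogeneous_X _ _).sub (isHomogeneous_X _ _)
    have h20 : (X 2 - X 0 : MvPolynomial (Fin 3) k).IsHomogeneous 1 :=
      (isHomogeneous_X _ _).sub (isHomogeneous_X _ _)
    have := (((isHomogeneous_X_pow (R := k) (0 : Fin 3) (i - s₂)).mul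
      (isHomogeneous_X_pow 1 (i - (i - s₂)))).mul (h12.pow (s₂ - i))).mul
      (h20.pow (j - (s₂ - i)))
    convert this using 1
    · simp
    · omega
  · simp only [AlgHom.toLinearMap_apply, map_mul, map_pow, map_neg, map_one, map_sub, aeval_X,
      Matrix.cons_val, pow_one, pow_zero, mul_one]
    rw [show (-1) ^ (j - (s₂ - i)) * (Polynomial.X ^ (i - s₂) * Polynomial.X ^ (i - (i - s₂)) *
      (Polynomial.X - 1) ^ (s₂ - i) * (1 - Polynomial.X) ^ (j - (s₂ - i))) =
      (Polynomial.X ^ (i - s₂) * Polynomial.X ^ (i - (i - s₂))) * ((Polynomial.X - 1) ^ (s₂ - i) *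
      ((-1) * (1 - Polynomial.X)) ^ (j - (s₂ - i)) : Polynomial k) by rw [mul_pow]; ring]
    rw [show ((-1) * (1 - Polynomial.X) : Polynomial k) = Polynomial.X - 1 by ring, ← pow_add,
      ← pow_add]
    congr 2 <;> omega

theorem X_pow_dvd_aeval_of_dvd_weightHom {s : ℕ} {F : MvPolynomial (Fin 3) k}
    (h : Polynomial.X ^ s ∣ weightHom ![1, 1, 0] F) :
    Polynomial.X ^ s ∣ aeval ![Polynomial.X, Polynomial.X, (1 : Polynomial k)] F := by
  let φ := Polynomial.mapAlgHom (aeval (1 : Fin 3 → k) : MvPolynomial (Fin 3) k →ₐ[k] k)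
  have h1 : φ.comp (weightHom ![1, 1, 0]) =
      aeval ![Polynomial.X, Polynomial.X, (1 : Polynomial k)] := by
    ext1 i
    fin_cases i <;> simp [φ, weightHom]
  have h2 := map_dvd φ h
  rw [map_pow, ← AlgHom.comp_apply, h1] at h2
  simpa [φ] using h2

theorem X_sub_one_pow_dvd_aeval_of_dvd_pointHom {n t : ℕ} (hn : (n : k) ≠ 0)
    {F : MvPolynomial (Fin 3) k}
    (h : Polynomial.X ^ t ∣ pointHom (1 : Fin 3 → k) (expand n F)) :
    (Polynomial.X - 1) ^ t ∣ aeval ![Polynomial.X, Polynomial.X, (1 : Polynomial k)] F := by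
  let φ := Polynomial.mapAlgHom (aeval (1 : Fin 3 → k) : MvPolynomial (Fin 3) k →ₐ[k] k)
  have h1 : (φ.comp (pointHom 1)).comp (expand n) =
      (Polynomial.aeval ((1 + Polynomial.X) ^ n : Polynomial k)).comp
        (aeval ![Polynomial.X, Polynomial.X, (1 : Polynomial k)]) := by
    ext1 i
    fin_cases i <;> simp [φ, pointHom]
  have h2 := map_dvd φ h
  have h3 := DFunLike.congr_fun h1 F
  simp only [AlgHom.comp_apply] at h3
  rw [map_pow, h3, ← Polynomial.comp_eq_aeval] at h2
  exact Polynomial.X_sub_one_pow_dvd_of_X_pow_dvd_comp hn (by simpa [φ] using h2)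

theorem not_dvd_weightHom_of_coeff_ne_zero (w : Fin 3 → ℕ) (i : Fin 3)
    {F : MvPolynomial (Fin 3) k} (hF : F.coeff (Finsupp.single i 1) ≠ 0) :
    ¬ Polynomial.X ^ (w i + 1) ∣ weightHom w F := by
  rw [X_pow_dvd_weightHom_iff]
  intro h
  have := h _ (mem_support_iff.2 hF)
  simp [Finsupp.single_apply] at this

theorem mem_binomialIdeal_one_of_dvd {n : ℕ} (hn : (n : k) ≠ 0) (d : ℕ) {t s₁ s₂ s₃ : ℕ}
    {F : MvPolynomial (Fin 3) k} (hF : F.IsHomogeneous d)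
    (h0 : Polynomial.X ^ t ∣ pointHom (1 : Fin 3 → k) (expand n F))
    (h1 : Polynomial.X ^ s₁ ∣ weightHom ![1, 1, 0] F)
    (h2 : Polynomial.X ^ s₂ ∣ weightHom ![0, 1, 1] F)
    (h3 : Polynomial.X ^ s₃ ∣ weightHom ![1, 0, 1] F) :
    F ∈ binomialIdeal k 1 t s₁ s₂ s₃ := by
  induction d using Nat.strong_induction_on generalizing t s₁ s₂ s₃ F with
  | _ d ih =>
  have hX : (X 2 : MvPolynomial (Fin 3) k).coeff (Finsupp.single 2 1) ≠ 0 := by simp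
  have hX₀ : (X 0 - X 1 : MvPolynomial (Fin 3) k).coeff (Finsupp.single 0 1) ≠ 0 := by
    simp [coeff_X, Finsupp.single_left_inj]
  have hX₁ : (X 0 - X 1 : MvPolynomial (Fin 3) k).coeff (Finsupp.single 1 1) ≠ 0 := by
    simp [coeff_X, Finsupp.single_left_inj]
  rcases eq_or_ne F 0 with rfl | hF0
  · exact zero_mem _
  rcases lt_or_ge d (s₂ + s₃) with hd | hd
  · obtain ⟨g₀, hg₀⟩ := X_two_dvd_of_lt hF h2 h3 hd
    obtain ⟨d', g, hd', hg, hFg⟩ :=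
      exists_isHomogeneous_of_mul_eq hF (isHomogeneous_X _ _) hg₀ hF0
    rw [hFg, map_mul] at h1 h2 h3
    rw [hFg, map_mul, map_mul] at h0
    rw [hFg]
    have e0 := Polynomial.prime_X.pow_sub_dvd_of_dvd_mul (pointHom_one_expand_X_two n) h0
    have e1 := Polynomial.prime_X.pow_sub_dvd_of_dvd_mul
      (not_dvd_weightHom_of_coeff_ne_zero ![1, 1, 0] 2 hX) h1
    have e2 := Polynomial.prime_X.pow_sub_dvd_of_dvd_mul
      (not_dvd_weightHom_of_coeff_ne_zero ![0, 1, 1] 2 hX) h2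
    have e3 := Polynomial.prime_X.pow_sub_dvd_of_dvd_mul
      (not_dvd_weightHom_of_coeff_ne_zero ![1, 0, 1] 2 hX) h3
    simp only [Matrix.cons_val, Nat.sub_zero] at e0 e1 e2 e3
    exact X_two_mul_mem_binomialIdeal (ih d' (by omega) hg e0 e1 e2 e3)
  · obtain ⟨G, hG, hGd, hGF⟩ := exists_mem_binomialIdeal_aeval_eq (t := t) (s₁ := s₁) hd
      (p := aeval ![Polynomial.X, Polynomial.X, (1 : Polynomial k)] F)
      (by
        have := MvPolynomial.aeval_natDegree_le F hF.totalDegree_le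
          ![Polynomial.X, Polynomial.X, (1 : Polynomial k)] (n := 1)
          (by intro i; fin_cases i <;> simp)
        simpa using this)
      (X_pow_dvd_aeval_of_dvd_weightHom h1) (X_sub_one_pow_dvd_aeval_of_dvd_pointHom hn h0)
    suffices F - G ∈ binomialIdeal k 1 t s₁ s₂ s₃ by simpa using add_mem this hG
    rcases eq_or_ne (F - G) 0 with hE | hE
    · rw [hE]; exact zero_mem _
    obtain ⟨f0, f1, f2, f3⟩ := dvd_of_mem_binomialIdeal (n := n) hG
    have hEd := hF.sub hGd
    obtain ⟨g₀, hg₀⟩ := exists_eq_X_zero_sub_X_one_mul hEd (by rw [map_sub, hGF, sub_self])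
    obtain ⟨d', g, hd', hg, hEg⟩ := exists_isHomogeneous_of_mul_eq hEd
      ((isHomogeneous_X _ _).sub (isHomogeneous_X _ _)) hg₀ hE
    have e0 := dvd_sub h0 f0
    have e1 := dvd_sub h1 f1
    have e2 := dvd_sub h2 f2
    have e3 := dvd_sub h3 f3
    rw [← map_sub, hEg, map_mul] at e1 e2 e3
    rw [← map_sub, ← map_sub, hEg, map_mul, map_mul] at e0
    have i0 := Polynomial.prime_X.pow_sub_dvd_of_dvd_mul (not_X_sq_dvd_pointHom_one hn) e0
    have i1 := Polynomial.prime_X.pow_sub_dvd_of_dvd_mul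
      (not_dvd_weightHom_of_coeff_ne_zero ![1, 1, 0] 0 hX₀) e1
    have i2 := Polynomial.prime_X.pow_sub_dvd_of_dvd_mul
      (not_dvd_weightHom_of_coeff_ne_zero ![0, 1, 1] 0 hX₀) e2
    have i3 := Polynomial.prime_X.pow_sub_dvd_of_dvd_mul
      (not_dvd_weightHom_of_coeff_ne_zero ![1, 0, 1] 1 hX₁) e3
    simp only [Matrix.cons_val, Nat.sub_zero] at i0 i1 i2 i3
    rw [hEg]
    exact X_zero_sub_X_one_mul_mem_binomialIdeal (ih d' (by omega) hg i0 i1 i2 i3)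

theorem Polynomial.coeff_mul_isHomogeneous {σ : Type*} {p q : Polynomial (MvPolynomial σ k)}
    {d e : ℕ} (hp : ∀ j, (p.coeff j).IsHomogeneous d) (hq : ∀ j, (q.coeff j).IsHomogeneous e)
    (j : ℕ) : ((p * q).coeff j).IsHomogeneous (d + e) := by
  rw [Polynomial.coeff_mul]
  exact IsHomogeneous.sum _ _ _ fun x _ => (hp _).mul (hq _)

theorem Polynomial.coeff_pow_isHomogeneous {σ : Type*} {p : Polynomial (MvPolynomial σ k)}
    (hp : ∀ j, (p.coeff j).IsHomogeneous 1) (e j : ℕ) : ((p ^ e).coeff j).IsHomogeneous e := by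
  induction e generalizing j with
  | zero =>
    rw [pow_zero, Polynomial.coeff_one]
    split_ifs
    · exact isHomogeneous_one _ _
    · exact isHomogeneous_zero _ _ _
  | succ e ih => rw [pow_succ]; exact Polynomial.coeff_mul_isHomogeneous ih hp j

theorem coeff_isHomogeneous_of_isHomogeneous
    {φ : MvPolynomial (Fin 3) k →ₐ[k] Polynomial (MvPolynomial (Fin 3) k)}
    (hφ : ∀ i j, ((φ (X i)).coeff j).IsHomogeneous 1) {d : ℕ} {F : MvPolynomial (Fin 3) k}
    (hF : F.IsHomogeneous d) (j : ℕ) : ((φ F).coeff j).IsHomogeneous d := by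
  rw [F.as_sum, map_sum, Polynomial.finsetSum_coeff]
  refine IsHomogeneous.sum _ _ _ fun m hm => ?_
  have h1 : φ (monomial m (F.coeff m)) =
      Polynomial.C (C (F.coeff m)) * (φ (X 0) ^ m 0 * φ (X 1) ^ m 1 * φ (X 2) ^ m 2) := by
    rw [monomial_eq, Finsupp.prod_fintype _ _ (by simp), map_mul, map_prod, Fin.prod_univ_three,
      map_pow, map_pow, map_pow, ← algebraMap_eq, AlgHom.commutes]
    rfl
  rw [h1, Polynomial.coeff_C_mul, ← hF.sum_eq hm]
  exact (Polynomial.coeff_mul_isHomogeneous (Polynomial.coeff_mul_isHomogeneous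
    (Polynomial.coeff_pow_isHomogeneous (hφ 0) _) (Polynomial.coeff_pow_isHomogeneous (hφ 1) _))
    (Polynomial.coeff_pow_isHomogeneous (hφ 2) _) j).C_mul _

theorem X_pow_dvd_homogeneousComponent
    {φ : MvPolynomial (Fin 3) k →ₐ[k] Polynomial (MvPolynomial (Fin 3) k)}
    (hφ : ∀ i j, ((φ (X i)).coeff j).IsHomogeneous 1) {N : ℕ} {F : MvPolynomial (Fin 3) k}
    (hF : Polynomial.X ^ N ∣ φ F) (d : ℕ) : Polynomial.X ^ N ∣ φ (homogeneousComponent d F) := by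
  rw [Polynomial.X_pow_dvd_iff] at hF ⊢
  intro j hj
  have h1 := congrArg (homogeneousComponent d) (hF j hj)
  have h2 : ∀ i, homogeneousComponent d ((φ (homogeneousComponent i F)).coeff j) =
      if i = d then (φ (homogeneousComponent i F)).coeff j else 0 := fun i => by
    rw [homogeneousComponent_of_mem (coeff_isHomogeneous_of_isHomogeneous hφ
      (homogeneousComponent_isHomogeneous i F) j)]
    simp [eq_comm]
  conv_lhs at h1 => rw [← sum_homogeneousComponent F]
  rw [map_sum, Polynomial.finsetSum_coeff, map_sum, map_zero, Finset.sum_congr rfl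
    (fun i _ => h2 i), Finset.sum_ite_eq'] at h1
  split_ifs at h1 with h3
  · exact h1
  · rw [Finset.mem_range, not_lt] at h3
    rw [homogeneousComponent_eq_zero _ _ (by omega), map_zero, Polynomial.coeff_zero]

theorem coeff_weightHom_X_isHomogeneous (w : Fin 3 → ℕ) (i : Fin 3) (j : ℕ) :
    ((weightHom (k := k) w (X i)).coeff j).IsHomogeneous 1 := by
  rw [weightHom, aeval_X, Polynomial.coeff_C_mul, Polynomial.coeff_X_pow]
  split_ifs
  · simpa using isHomogeneous_X k i
  · simpa using isHomogeneous_zero (Fin 3) k 1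

theorem coeff_pointHom_X_isHomogeneous (ζ : Fin 3 → k) (i : Fin 3) (j : ℕ) :
    ((pointHom ζ (X i)).coeff j).IsHomogeneous 1 := by
  rw [pointHom, aeval_X, Polynomial.coeff_C_mul]
  refine IsHomogeneous.C_mul ?_ _
  have h1 : ∀ l j, ((Polynomial.C (X l : MvPolynomial (Fin 3) k)).coeff j).IsHomogeneous 1 := by
    intro l j
    rw [Polynomial.coeff_C]
    split_ifs
    · exact isHomogeneous_X k l
    · exact isHomogeneous_zero (Fin 3) k 1
  have h2 : ∀ l j, ((Polynomial.C (X l : MvPolynomial (Fin 3) k) * Polynomial.X).coeff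
      j).IsHomogeneous 1 := by
    intro l j
    rcases j with _ | j
    · simpa using isHomogeneous_zero (Fin 3) k 1
    · rw [Polynomial.coeff_mul_X]
      exact h1 l j
  fin_cases i
  · change ((Polynomial.C (X 2) + Polynomial.C (X 0) * Polynomial.X :
      Polynomial (MvPolynomial (Fin 3) k)).coeff j).IsHomogeneous 1
    rw [Polynomial.coeff_add]
    exact (h1 2 j).add (h2 0 j)
  · change ((Polynomial.C (X 2) + Polynomial.C (X 1) * Polynomial.X :
      Polynomial (MvPolynomial (Fin 3) k)).coeff j).IsHomogeneous 1
    rw [Polynomial.coeff_add]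
    exact (h1 2 j).add (h2 1 j)
  · exact h1 2 j

/-- The residues modulo `n` of an exponent vector. -/
def residue (n : ℕ) [NeZero n] (m : Fin 3 →₀ ℕ) : Fin 3 → Fin n := fun i => Fin.ofNat n (m i)

theorem coeff_aeval_C_mul_X (ζ : Fin 3 → k) (f : MvPolynomial (Fin 3) k) (m : Fin 3 →₀ ℕ) :
    (aeval (fun i => C (ζ i) * X i) f).coeff m = (∏ i, ζ i ^ m i) * f.coeff m := by
  induction f using MvPolynomial.induction_on' with
  | monomial u a =>
    rw [aeval_monomial, Finsupp.prod_fintype _ _ (by simp)]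
    have : (monomial u a : MvPolynomial (Fin 3) k) = C a * ∏ i, X i ^ u i := by
      rw [monomial_eq, Finsupp.prod_fintype _ _ (by simp)]
    simp only [mul_pow, Finset.prod_mul_distrib, ← map_pow, ← map_prod]
    rw [algebraMap_eq, mul_left_comm, ← this, coeff_C_mul, coeff_monomial]
    split_ifs with h
    · rw [h]
    · simp
  | add p q hp hq => rw [map_add, coeff_add, coeff_add, hp, hq, mul_add]

theorem IsPrimitiveRoot.sum_pow_mul_eq {n : ℕ} {ω : k} (hω : IsPrimitiveRoot ω n) [NeZero n]
    (m : ℕ) (c : Fin n) :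
    ∑ p : Fin n, (ω ^ (m + (n - c))) ^ (p : ℕ) = if Fin.ofNat n m = c then (n : k) else 0 := by
  rw [Fin.sum_univ_eq_sum_range (fun p => (ω ^ (m + (n - c))) ^ p) n]
  have hc := c.2
  have h1 : Fin.ofNat n m = c ↔ n ∣ m + (n - c) := by
    rw [Fin.ext_iff, Fin.val_ofNat, ← Nat.modEq_zero_iff_dvd]
    have h2 : m % n = c ↔ m ≡ c [MOD n] := by
      rw [Nat.ModEq, Nat.mod_eq_of_lt hc]
    rw [h2]
    have h3 : (c : ℕ) + (n - c) ≡ 0 [MOD n] := by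
      rw [Nat.add_sub_cancel' hc.le, Nat.modEq_zero_iff_dvd]
    exact ⟨fun h => (h.add_right _).trans h3, fun h => (h.trans h3.symm).add_right_cancel' _⟩
  split_ifs with h
  · rw [(hω.pow_eq_one_iff_dvd _).2 (h1.1 h)]
    simp
  · have h2 : ω ^ (m + (n - c)) ≠ 1 := fun h' => h (h1.2 ((hω.pow_eq_one_iff_dvd _).1 h'))
    rw [geom_sum_eq h2, ← pow_mul, mul_comm, pow_mul, hω.pow_eq_one]
    simp

theorem sum_C_mul_aeval_eq {n : ℕ} {ω : k} (hω : IsPrimitiveRoot ω n) [NeZero n]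
    (f : MvPolynomial (Fin 3) k) (κ : Fin 3 → Fin n) :
    ∑ g : Fin 3 → Fin n, C (∏ i, (ω ^ (n - κ i : ℕ)) ^ (g i : ℕ)) *
      aeval (fun i => C (ω ^ (g i : ℕ)) * X i) f =
    C ((n : k) ^ 3) * ∑ m ∈ f.support with residue n m = κ, monomial m (f.coeff m) := by
  ext m
  simp only [coeff_sum, coeff_C_mul, coeff_aeval_C_mul_X, coeff_monomial, ← mul_assoc,
    ← Finset.sum_mul, ← Finset.prod_mul_distrib]
  have h1 : ∀ x : Fin 3 → Fin n, ∏ i, (ω ^ (n - κ i : ℕ)) ^ (x i : ℕ) * (ω ^ (x i : ℕ)) ^ m i =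
      ∏ i, (ω ^ (m i + (n - κ i))) ^ (x i : ℕ) := fun x => Finset.prod_congr rfl fun i _ => by
    rw [← pow_mul, ← pow_mul, ← pow_mul, ← pow_add]
    congr 1
    ring
  simp_rw [h1]
  rw [← Fintype.prod_sum (fun i (p : Fin n) => (ω ^ (m i + (n - κ i))) ^ (p : ℕ)),
    Finset.prod_congr rfl fun i _ => hω.sum_pow_mul_eq (m i) (κ i)]
  rw [Finset.sum_ite_eq']
  by_cases hm : residue n m = κ
  · have h2 : ∀ i, Fin.ofNat n (m i) = κ i := fun i => congrFun hm i
    simp only [h2, if_true, Finset.prod_const, Finset.card_univ, Fintype.card_fin,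
      Finset.mem_filter, hm, and_true]
    split_ifs with h
    · rfl
    · rw [notMem_support_iff.1 h]
  · obtain ⟨i, hi⟩ := Function.ne_iff.1 hm
    rw [Finset.prod_eq_zero (Finset.mem_univ i) (if_neg hi)]
    simp [hm]

theorem pointHom_eq_pointHom_one (ζ : Fin 3 → k) (f : MvPolynomial (Fin 3) k) :
    pointHom ζ f = pointHom 1 (aeval (fun i => C (ζ i) * X i) f) := by
  suffices pointHom ζ = (pointHom 1).comp (aeval fun i => C (ζ i) * X i) from
    DFunLike.congr_fun this f
  ext1 i
  rw [AlgHom.comp_apply, aeval_X, map_mul, pointHom, pointHom, aeval_X, aeval_X, ← algebraMap_eq,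
    AlgHom.commutes]
  simp

theorem X_pow_dvd_pointHom_one_residue {n N : ℕ} {ω : k} (hω : IsPrimitiveRoot ω n) [NeZero n]
    (hn : (n : k) ≠ 0) {f : MvPolynomial (Fin 3) k}
    (hf : ∀ ζ : Fin 3 → k, (∀ i, ζ i ^ n = 1) → Polynomial.X ^ N ∣ pointHom ζ f)
    (κ : Fin 3 → Fin n) :
    Polynomial.X ^ N ∣ pointHom (1 : Fin 3 → k)
      (∑ m ∈ f.support with residue n m = κ, monomial m (f.coeff m)) := by
  have h1 : Polynomial.X ^ N ∣ pointHom (1 : Fin 3 → k)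
      (C ((n : k) ^ 3) * ∑ m ∈ f.support with residue n m = κ, monomial m (f.coeff m)) := by
    rw [← sum_C_mul_aeval_eq hω, map_sum]
    refine Finset.dvd_sum fun g _ => ?_
    rw [map_mul, ← pointHom_eq_pointHom_one (fun i => ω ^ (g i : ℕ))]
    refine Dvd.dvd.mul_left (hf _ fun i => ?_) _
    rw [← pow_mul, mul_comm, pow_mul, hω.pow_eq_one, one_pow]
  rw [map_mul, ← algebraMap_eq, AlgHom.commutes] at h1
  have h2 : IsUnit (algebraMap k (Polynomial (MvPolynomial (Fin 3) k)) ((n : k) ^ 3)) :=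
    (isUnit_iff_ne_zero.2 (pow_ne_zero _ hn)).map _
  exact h2.dvd_mul_left.1 h1

theorem mul_expand_mem_binomialIdeal {n t N s₁ s₂ s₃ a b c : ℕ} {F : MvPolynomial (Fin 3) k}
    (hF : F ∈ binomialIdeal k 1 t s₁ s₂ s₃) (h₁ : N ≤ a + b + n * s₁)
    (h₂ : N ≤ b + c + n * s₂) (h₃ : N ≤ a + c + n * s₃) :
    X 0 ^ a * X 1 ^ b * X 2 ^ c * expand n F ∈ binomialIdeal k n t N N N := by
  refine Submodule.span_induction (p := fun F _ => X 0 ^ a * X 1 ^ b * X 2 ^ c * expand n F ∈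
    binomialIdeal k n t N N N) ?_ ?_ ?_ ?_ hF
  · rintro _ ⟨a', b', c', d, e, f, ht, hs₁, hs₂, hs₃, rfl⟩
    refine Ideal.subset_span ⟨a + n * a', b + n * b', c + n * c', d, e, f, ht, ?_, ?_, ?_, ?_⟩
    · have := Nat.mul_le_mul_left n hs₁
      linarith
    · have := Nat.mul_le_mul_left n hs₂
      linarith
    · have := Nat.mul_le_mul_left n hs₃
      linarith
    · simp only [map_mul, map_pow, map_sub, expand_X, pow_one, pow_add, pow_mul]
      ring
  · simp
  · intro p q _ _ hp hq
    rw [map_add, mul_add]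
    exact add_mem hp hq
  · intro r p _ hp
    rw [smul_eq_mul, map_mul, mul_left_comm]
    exact Ideal.mul_mem_left _ _ hp

/-- A form all of whose exponent vectors have the residues `κ` modulo `n`, up to the factor
`X ^ κ`, is a form in the `n`-th powers of the variables. -/
theorem exists_eq_mul_expand {n : ℕ} [NeZero n] {d : ℕ} {f : MvPolynomial (Fin 3) k}
    (hf : f.IsHomogeneous d) (κ : Fin 3 → Fin n) :
    ∃ F : MvPolynomial (Fin 3) k, ∃ e, F.IsHomogeneous e ∧
      ∑ m ∈ f.support with residue n m = κ, monomial m (f.coeff m) =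
        X 0 ^ (κ 0 : ℕ) * X 1 ^ (κ 1 : ℕ) * X 2 ^ (κ 2 : ℕ) * expand n F ∧
      ∀ m' ∈ F.support, ∃ m ∈ f.support, ∀ i, m i = κ i + n * m' i := by
  set S := f.support.filter fun m => residue n m = κ with hS
  let q : (Fin 3 →₀ ℕ) → (Fin 3 →₀ ℕ) := fun m => m.mapRange (· / n) (Nat.zero_div n)
  have hq : ∀ m ∈ S, ∀ i, m i = κ i + n * q m i := fun m hm i => by
    have h1 := congrFun (Finset.mem_filter.1 hm).2 i
    rw [← h1]
    exact (Nat.mod_add_div (m i) n).symm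
  have hn : 0 < n := NeZero.pos n
  refine ⟨∑ m ∈ S, monomial (q m) (f.coeff m), (d - (κ 0 + κ 1 + κ 2)) / n, ?_, ?_, ?_⟩
  · refine IsHomogeneous.sum _ _ _ fun m hm => isHomogeneous_monomial _ ?_
    rw [Finsupp.degree_eq_sum, Fin.sum_univ_three]
    symm
    apply Nat.div_eq_of_eq_mul_right hn
    have h1 := hf.sum_eq (Finset.mem_filter.1 hm).1
    have h2 := hq m hm 0
    have h3 := hq m hm 1
    have h4 := hq m hm 2
    rw [mul_add, mul_add]
    omega
  · rw [map_sum, Finset.mul_sum]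
    refine Finset.sum_congr rfl fun m hm => ?_
    simp only [expand_monomial, monomial_eq (s := m), Finsupp.prod_fintype, pow_zero,
      implies_true, Fin.prod_univ_three]
    rw [hq m hm 0, hq m hm 1, hq m hm 2, monomial_eq, Finsupp.prod_fintype _ _ (by simp),
      Fin.prod_univ_three]
    simp only [pow_add, Finsupp.smul_apply, smul_eq_mul]
    ring
  · intro m' hm'
    obtain ⟨m, hm, h⟩ := Finset.exists_ne_zero_of_sum_ne_zero
      (by rw [mem_support_iff, coeff_sum] at hm'; exact hm')
    rw [coeff_monomial] at h
    obtain rfl : q m = m' := by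
      by_contra h'
      exact h (if_neg h')
    exact ⟨m, (Finset.mem_filter.1 hm).1, hq m hm⟩

theorem not_X_dvd_pointHom_one_X (i : Fin 3) :
    ¬ Polynomial.X ∣ pointHom (1 : Fin 3 → k) (X i) := by
  rw [Polynomial.X_dvd_iff, Polynomial.coeff_zero_eq_eval_zero]
  fin_cases i <;> simp [pointHom]

theorem X_pow_dvd_weightHom_of_ceilDiv {n N c s : ℕ} (hn : 0 < n) {w : Fin 3 → ℕ}
    {f F : MvPolynomial (Fin 3) k} {κ : Fin 3 → ℕ} (hc : ∑ i, κ i * w i = c)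
    (hs : s = (N - c) ⌈/⌉ n)
    (hf : Polynomial.X ^ N ∣ weightHom w f)
    (hF : ∀ m' ∈ F.support, ∃ m ∈ f.support, ∀ i, m i = κ i + n * m' i) :
    Polynomial.X ^ s ∣ weightHom w F := by
  rw [X_pow_dvd_weightHom_iff] at hf ⊢
  intro m' hm'
  obtain ⟨m, hm, h⟩ := hF m' hm'
  rw [hs, ceilDiv_le_iff_le_mul hn, Nat.sub_le_iff_le_add', ← hc, Finset.mul_sum,
    ← Finset.sum_add_distrib]
  refine (hf m hm).trans (Finset.sum_le_sum fun i _ => ?_)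
  rw [h i]
  exact le_of_eq (by ring)

theorem mem_binomialIdeal_of_isHomogeneous {n N : ℕ} {ω : k} (hω : IsPrimitiveRoot ω n) [NeZero n]
    (hn : (n : k) ≠ 0) {d : ℕ} {f : MvPolynomial (Fin 3) k} (hfd : f.IsHomogeneous d)
    (hf : ∀ ζ : Fin 3 → k, (∀ i, ζ i ^ n = 1) → Polynomial.X ^ N ∣ pointHom ζ f)
    (h₁ : Polynomial.X ^ N ∣ weightHom ![1, 1, 0] f)
    (h₂ : Polynomial.X ^ N ∣ weightHom ![0, 1, 1] f)
    (h₃ : Polynomial.X ^ N ∣ weightHom ![1, 0, 1] f) : f ∈ binomialIdeal k n N N N N := by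
  have hsum : f = ∑ κ : Fin 3 → Fin n,
      ∑ m ∈ f.support with residue n m = κ, monomial m (f.coeff m) := by
    rw [Finset.sum_fiberwise]
    exact f.as_sum
  rw [hsum]
  refine sum_mem fun κ _ => ?_
  have hpt := X_pow_dvd_pointHom_one_residue hω hn hf κ
  obtain ⟨F, e, hFe, hF, hsupp⟩ := exists_eq_mul_expand hfd κ
  rw [hF] at hpt ⊢
  have hn' : 0 < n := NeZero.pos n
  have hle : ∀ c, N ≤ c + n * ((N - c) ⌈/⌉ n) := fun c => by
    have := le_smul_ceilDiv (a := n) (b := N - c) hn'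
    rw [smul_eq_mul] at this
    omega
  refine mul_expand_mem_binomialIdeal (mem_binomialIdeal_one_of_dvd hn e hFe ?_
    (X_pow_dvd_weightHom_of_ceilDiv hn' ?_ rfl h₁ hsupp)
    (X_pow_dvd_weightHom_of_ceilDiv hn' ?_ rfl h₂ hsupp)
    (X_pow_dvd_weightHom_of_ceilDiv hn' ?_ rfl h₃ hsupp)) (hle _) (hle _) (hle _)
  · have hX := Polynomial.prime_X (R := MvPolynomial (Fin 3) k)
    rw [map_mul, map_mul, map_mul, map_pow, map_pow, map_pow] at hpt
    refine hX.pow_dvd_of_dvd_mul_left _ (fun h => ?_) hpt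
    rcases hX.dvd_or_dvd h with h | h
    · rcases hX.dvd_or_dvd h with h | h
      · exact not_X_dvd_pointHom_one_X _ (hX.dvd_of_dvd_pow h)
      · exact not_X_dvd_pointHom_one_X _ (hX.dvd_of_dvd_pow h)
    · exact not_X_dvd_pointHom_one_X _ (hX.dvd_of_dvd_pow h)
  all_goals simp [Fin.sum_univ_three]

/-- A polynomial that vanishes to order `N` at the singular points of the Fermat arrangement is a
combination of products of coordinates and binomials doing so. -/
theorem mem_binomialIdeal_of_dvd {n N : ℕ} {ω : k} (hω : IsPrimitiveRoot ω n) [NeZero n]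
    (hn : (n : k) ≠ 0) {f : MvPolynomial (Fin 3) k}
    (hf : ∀ ζ : Fin 3 → k, (∀ i, ζ i ^ n = 1) → Polynomial.X ^ N ∣ pointHom ζ f)
    (h₁ : Polynomial.X ^ N ∣ weightHom ![1, 1, 0] f)
    (h₂ : Polynomial.X ^ N ∣ weightHom ![0, 1, 1] f)
    (h₃ : Polynomial.X ^ N ∣ weightHom ![1, 0, 1] f) : f ∈ binomialIdeal k n N N N N := by
  rw [← sum_homogeneousComponent f]
  exact sum_mem fun d _ => mem_binomialIdeal_of_isHomogeneous hω hn
    (homogeneousComponent_isHomogeneous d f)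
    (fun ζ hζ => X_pow_dvd_homogeneousComponent (coeff_pointHom_X_isHomogeneous ζ) (hf ζ hζ) d)
    (X_pow_dvd_homogeneousComponent (coeff_weightHom_X_isHomogeneous _) h₁ d)
    (X_pow_dvd_homogeneousComponent (coeff_weightHom_X_isHomogeneous _) h₂ d)
    (X_pow_dvd_homogeneousComponent (coeff_weightHom_X_isHomogeneous _) h₃ d)

theorem AdmissibleExponents.mem_binomialIdeal {n N a b c d e f : ℕ}
    (h : AdmissibleExponents n N a b c d e f) :
    (X 0 ^ a * X 1 ^ b * X 2 ^ c * (X 0 ^ n - X 1 ^ n) ^ d * (X 1 ^ n - X 2 ^ n) ^ e *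
      (X 2 ^ n - X 0 ^ n) ^ f : MvPolynomial (Fin 3) k) ∈ binomialIdeal k n N N N N :=
  Ideal.subset_span ⟨a, b, c, d, e, f, h.1, h.2.1, h.2.2.1, h.2.2.2, rfl⟩

theorem binomialIdeal_le {n N : ℕ} {J : Ideal (MvPolynomial (Fin 3) k)}
    (h : ∀ a b c d e f, AdmissibleExponents n N a b c d e f →
      X 0 ^ a * X 1 ^ b * X 2 ^ c * (X 0 ^ n - X 1 ^ n) ^ d * (X 1 ^ n - X 2 ^ n) ^ e *
        (X 2 ^ n - X 0 ^ n) ^ f ∈ J) : binomialIdeal k n N N N N ≤ J := by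
  refine Ideal.span_le.2 ?_
  rintro _ ⟨a, b, c, d, e, f, h0, h1, h2, h3, rfl⟩
  exact h a b c d e f ⟨h0, h1, h2, h3⟩

theorem binomialIdeal_mul_le (n M N : ℕ) :
    binomialIdeal k n M M M M * binomialIdeal k n N N N N ≤
      binomialIdeal k n (M + N) (M + N) (M + N) (M + N) := by
  rw [binomialIdeal, binomialIdeal, Ideal.span_mul_span', Ideal.span_le]
  rintro _ ⟨_, ⟨a, b, c, d, e, f, h0, h1, h2, h3, rfl⟩,
    _, ⟨a', b', c', d', e', f', h0', h1', h2', h3', rfl⟩, rfl⟩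
  have h : AdmissibleExponents n (M + N) (a + a') (b + b') (c + c') (d + d') (e + e') (f + f') :=
    ⟨by omega, by rw [mul_add]; omega, by rw [mul_add]; omega, by rw [mul_add]; omega⟩
  rw [SetLike.mem_coe]
  convert h.mem_binomialIdeal (k := k) using 1
  ring

theorem binomialIdeal_add_le_mul {n : ℕ} (hn : 3 ≤ n) (s : ℕ) :
    binomialIdeal k n (n * s + n) (n * s + n) (n * s + n) (n * s + n) ≤
      binomialIdeal k n n n n n * binomialIdeal k n (n * s) (n * s) (n * s) (n * s) := by
  refine binomialIdeal_le fun a b c d e f h => ?_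
  obtain ⟨a₁, b₁, c₁, d₁, e₁, f₁, a₂, b₂, c₂, d₂, e₂, f₂, rfl, rfl, rfl, rfl, rfl, rfl, h₁, h₂⟩ :=
    h.splittable hn
  convert Ideal.mul_mem_mul (h₁.mem_binomialIdeal (k := k)) (h₂.mem_binomialIdeal (k := k)) using 1
  ring

theorem binomialIdeal_mul_le_pow {n : ℕ} (hn : 3 ≤ n) (s : ℕ) :
    binomialIdeal k n (n * s) (n * s) (n * s) (n * s) ≤ binomialIdeal k n n n n n ^ s := by
  induction s with
  | zero => simp
  | succ s ih =>
    rw [pow_succ', Nat.mul_succ]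
    exact (binomialIdeal_add_le_mul hn s).trans (Ideal.mul_mono_right ih)

theorem binomialIdeal_pow_le (n s : ℕ) :
    binomialIdeal k n n n n n ^ s ≤ binomialIdeal k n (n * s) (n * s) (n * s) (n * s) := by
  induction s with
  | zero =>
    rw [pow_zero, Ideal.one_eq_top, top_le_iff, Ideal.eq_top_iff_one, mul_zero]
    have h : AdmissibleExponents n 0 0 0 0 0 0 0 := by simp [AdmissibleExponents]
    simpa using h.mem_binomialIdeal (k := k)
  | succ s ih =>
    rw [pow_succ, Nat.mul_succ]
    exact (Ideal.mul_mono_left ih).trans (binomialIdeal_mul_le n _ _)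

theorem binomialIdeal_succ_le {n : ℕ} (hn : n ≠ 0) (N : ℕ) :
    binomialIdeal k n (N + 1) (N + 1) (N + 1) (N + 1) ≤
      Ideal.span (Set.range X) * binomialIdeal k n N N N N := by
  obtain ⟨n, rfl⟩ := Nat.exists_eq_add_one_of_ne_zero hn
  refine binomialIdeal_le fun a b c d e f ⟨h0, h1, h2, h3⟩ => ?_
  have hX : ∀ i : Fin 3, (X i : MvPolynomial (Fin 3) k) ∈ Ideal.span (Set.range X) := fun i =>
    Ideal.subset_span ⟨i, rfl⟩
  have hd : d ≠ 0 ∨ e ≠ 0 ∨ f ≠ 0 := by omega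
  rcases hd with hd | hd | hd
  · obtain ⟨d, rfl⟩ := Nat.exists_eq_add_one_of_ne_zero hd
    rw [Nat.mul_succ] at h1
    have hx : AdmissibleExponents (n + 1) N (a + n) b c d e f :=
      ⟨by omega, by omega, by omega, by omega⟩
    have hy : AdmissibleExponents (n + 1) N a (b + n) c d e f :=
      ⟨by omega, by omega, by omega, by omega⟩
    convert sub_mem (Ideal.mul_mem_mul (hX 0) hx.mem_binomialIdeal)
      (Ideal.mul_mem_mul (hX 1) hy.mem_binomialIdeal) using 1
    ring
  · obtain ⟨e, rfl⟩ := Nat.exists_eq_add_one_of_ne_zero hd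
    rw [Nat.mul_succ] at h2
    have hx : AdmissibleExponents (n + 1) N a (b + n) c d e f :=
      ⟨by omega, by omega, by omega, by omega⟩
    have hy : AdmissibleExponents (n + 1) N a b (c + n) d e f :=
      ⟨by omega, by omega, by omega, by omega⟩
    convert sub_mem (Ideal.mul_mem_mul (hX 1) hx.mem_binomialIdeal)
      (Ideal.mul_mem_mul (hX 2) hy.mem_binomialIdeal) using 1
    ring
  · obtain ⟨f, rfl⟩ := Nat.exists_eq_add_one_of_ne_zero hd
    rw [Nat.mul_succ] at h3
    have hx : AdmissibleExponents (n + 1) N a b (c + n) d e f :=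
      ⟨by omega, by omega, by omega, by omega⟩
    have hy : AdmissibleExponents (n + 1) N (a + n) b c d e f :=
      ⟨by omega, by omega, by omega, by omega⟩
    convert sub_mem (Ideal.mul_mem_mul (hX 2) hx.mem_binomialIdeal)
      (Ideal.mul_mem_mul (hX 0) hy.mem_binomialIdeal) using 1
    ring

theorem binomialIdeal_add_le {n : ℕ} (hn : n ≠ 0) (N r : ℕ) :
    binomialIdeal k n (N + r) (N + r) (N + r) (N + r) ≤
      Ideal.span (Set.range X) ^ r * binomialIdeal k n N N N N := by
  induction r with
  | zero => simp
  | succ r ih =>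
    rw [← add_assoc, pow_succ', mul_assoc]
    exact (binomialIdeal_succ_le hn _).trans (Ideal.mul_mono_right ih)

theorem mul_pow_eq_zero_of_pos {A : Type*} [CommRing A] {n : ℕ} {x y z : A}
    (hx : x * (y ^ n - z ^ n) = 0) (hy : y * (z ^ n - x ^ n) = 0) (hz : z * (x ^ n - y ^ n) = 0)
    {a b c d e f : ℕ} (hn : n ≠ 0) (hd : d ≠ 0) (h₂ : b ≠ 0 ∨ c ≠ 0 ∨ e ≠ 0)
    (h₃ : a ≠ 0 ∨ c ≠ 0 ∨ f ≠ 0) :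
    x ^ a * y ^ b * z ^ c * (x ^ n - y ^ n) ^ d * (y ^ n - z ^ n) ^ e * (z ^ n - x ^ n) ^ f = 0 := by
  obtain ⟨d, rfl⟩ := Nat.exists_eq_add_one_of_ne_zero hd
  by_cases hc : c ≠ 0
  · obtain ⟨c, rfl⟩ := Nat.exists_eq_add_one_of_ne_zero hc
    linear_combination (x ^ a * y ^ b * z ^ c * (x ^ n - y ^ n) ^ d * (y ^ n - z ^ n) ^ e *
      (z ^ n - x ^ n) ^ f) * hz
  simp only [hc, false_or] at h₂ h₃
  rcases h₂ with h₂ | h₂ <;> rcases h₃ with h₃ | h₃ <;>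
    obtain ⟨i, rfl⟩ := Nat.exists_eq_add_one_of_ne_zero h₂ <;>
    obtain ⟨j, rfl⟩ := Nat.exists_eq_add_one_of_ne_zero h₃
  · linear_combination (-(x ^ j * y ^ i * z ^ c * (x ^ n - y ^ n) ^ d * (y ^ n - z ^ n) ^ e *
      (z ^ n - x ^ n) ^ f)) * (y * hx + x * hy)
  · linear_combination (x ^ a * y ^ i * z ^ c * (x ^ n - y ^ n) ^ (d + 1) * (y ^ n - z ^ n) ^ e *
      (z ^ n - x ^ n) ^ j) * hy
  · linear_combination (x ^ j * y ^ b * z ^ c * (x ^ n - y ^ n) ^ (d + 1) * (y ^ n - z ^ n) ^ i *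
      (z ^ n - x ^ n) ^ f) * hx
  · obtain ⟨n, rfl⟩ := Nat.exists_eq_add_one_of_ne_zero hn
    linear_combination (x ^ a * y ^ b * z ^ c * (x ^ (n + 1) - y ^ (n + 1)) ^ d *
      (y ^ (n + 1) - z ^ (n + 1)) ^ i * (z ^ (n + 1) - x ^ (n + 1)) ^ j) *
      (z ^ n * (y ^ (n + 1) - z ^ (n + 1)) * hz - x ^ n * (x ^ (n + 1) - y ^ (n + 1)) * hx)

theorem AdmissibleExponents.mul_pow_eq_zero {A : Type*} [CommRing A] {n : ℕ} {x y z : A}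
    (hx : x * (y ^ n - z ^ n) = 0) (hy : y * (z ^ n - x ^ n) = 0) (hz : z * (x ^ n - y ^ n) = 0)
    {a b c d e f : ℕ} (hn : n ≠ 0) (h : AdmissibleExponents n 1 a b c d e f) :
    x ^ a * y ^ b * z ^ c * (x ^ n - y ^ n) ^ d * (y ^ n - z ^ n) ^ e * (z ^ n - x ^ n) ^ f = 0 := by
  obtain ⟨h0, h1, h2, h3⟩ := h
  have key : ∀ {p q g : ℕ}, 1 ≤ p + q + n * g → p ≠ 0 ∨ q ≠ 0 ∨ g ≠ 0 := fun {p q g} h => by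
    by_contra! h'
    simp [h'.1, h'.2.1, h'.2.2] at h
  have hd : d ≠ 0 ∨ e ≠ 0 ∨ f ≠ 0 := by omega
  rcases hd with hd | hd | hd
  · exact mul_pow_eq_zero_of_pos hx hy hz hn hd (key h2) (key h3)
  · rw [← mul_pow_eq_zero_of_pos hy hz hx (a := b) (b := c) (c := a) (e := f) (f := d) hn hd
      (key (by omega)) (key (by omega))]
    ring
  · rw [← mul_pow_eq_zero_of_pos hz hx hy (a := c) (b := a) (c := b) (e := d) (f := e) hn hd
      (key (by omega)) (key (by omega))]
    ring

variable (k) in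
/-- The ideal of the singular points of the Fermat arrangement. -/
noncomputable def fermatIdeal (n : ℕ) : Ideal (MvPolynomial (Fin 3) k) :=
  Ideal.span {X 0 * (X 1 ^ n - X 2 ^ n), X 1 * (X 2 ^ n - X 0 ^ n), X 2 * (X 0 ^ n - X 1 ^ n)}

theorem X_zero_mul_mem_fermatIdeal (n : ℕ) : X 0 * (X 1 ^ n - X 2 ^ n) ∈ fermatIdeal k n :=
  Ideal.subset_span (by simp)

theorem X_one_mul_mem_fermatIdeal (n : ℕ) : X 1 * (X 2 ^ n - X 0 ^ n) ∈ fermatIdeal k n :=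
  Ideal.subset_span (by simp)

theorem X_two_mul_mem_fermatIdeal (n : ℕ) : X 2 * (X 0 ^ n - X 1 ^ n) ∈ fermatIdeal k n :=
  Ideal.subset_span (by simp)

theorem binomialIdeal_one_le_fermatIdeal {n : ℕ} (hn : n ≠ 0) :
    binomialIdeal k n 1 1 1 1 ≤ fermatIdeal k n := by
  refine binomialIdeal_le fun a b c d e f h => ?_
  have hx := Ideal.Quotient.eq_zero_iff_mem.2 (X_zero_mul_mem_fermatIdeal (k := k) n)
  have hy := Ideal.Quotient.eq_zero_iff_mem.2 (X_one_mul_mem_fermatIdeal (k := k) n)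
  have hz := Ideal.Quotient.eq_zero_iff_mem.2 (X_two_mul_mem_fermatIdeal (k := k) n)
  rw [← Ideal.Quotient.eq_zero_iff_mem]
  simp only [map_mul, map_pow, map_sub] at hx hy hz ⊢
  exact h.mul_pow_eq_zero hx hy hz hn

theorem comap_span_X_mem_associatedPrimes {I : Ideal (MvPolynomial (Fin 3) k)}
    {φ : MvPolynomial (Fin 3) k →ₐ[k] Polynomial (MvPolynomial (Fin 3) k)}
    (hI : I ≤ (Ideal.span {Polynomial.X}).comap φ) {g : MvPolynomial (Fin 3) k}
    (hg : (φ g).eval 0 ≠ 0) (ρ : MvPolynomial (Fin 3) k →ₐ[k] MvPolynomial (Fin 3) k)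
    (hρ : ∀ i, (X i - ρ ((φ (X i)).eval 0)) * g ∈ I) :
    (Ideal.span {Polynomial.X}).comap φ ∈
      associatedPrimes (MvPolynomial (Fin 3) k) (MvPolynomial (Fin 3) k ⧸ I) := by
  have hX := Polynomial.prime_X (R := MvPolynomial (Fin 3) k)
  have hprime : (Ideal.span {(Polynomial.X : Polynomial (MvPolynomial (Fin 3) k))}).IsPrime :=
    (Ideal.span_singleton_prime hX.ne_zero).2 hX
  have hP : ((Ideal.span {Polynomial.X}).comap φ).IsPrime := Ideal.comap_isPrime _ _
  have hmem : ∀ r, r ∈ (Ideal.span {Polynomial.X}).comap φ ↔ (φ r).eval 0 = 0 := fun r => by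
    rw [Ideal.mem_comap, Ideal.mem_span_singleton, Polynomial.X_dvd_iff,
      Polynomial.coeff_zero_eq_eval_zero]
  refine ⟨hP, Ideal.Quotient.mk I g, ?_⟩
  set K : Ideal (MvPolynomial (Fin 3) k) :=
    Submodule.colon (⊥ : Submodule (MvPolynomial (Fin 3) k) (MvPolynomial (Fin 3) k ⧸ I))
      {Ideal.Quotient.mk I g} with hK
  have hKmem : ∀ r, r ∈ K ↔ r * g ∈ I := fun r => by
    rw [hK, Submodule.mem_colon_singleton, Submodule.mem_bot, ← Ideal.Quotient.eq_zero_iff_mem,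
      map_mul]
    rfl
  suffices (Ideal.span {Polynomial.X}).comap φ = K by rw [← this, hP.radical]
  ext r
  rw [hKmem]
  constructor
  · intro hr
    let ev : MvPolynomial (Fin 3) k →ₐ[k] MvPolynomial (Fin 3) k :=
      ((Polynomial.aeval (R := MvPolynomial (Fin 3) k) 0).restrictScalars k).comp φ
    have hev : ∀ p, ev p = (φ p).eval 0 := fun p => by
      simp [ev]
    have h1 : Ideal.Quotient.mkₐ k K = (Ideal.Quotient.mkₐ k K).comp (ρ.comp ev) := by
      ext1 i
      rw [AlgHom.comp_apply, AlgHom.comp_apply, hev]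
      exact Ideal.Quotient.eq.2 ((hKmem _).2 (hρ i))
    have h2 := DFunLike.congr_fun h1 r
    rw [AlgHom.comp_apply, AlgHom.comp_apply, hev, (hmem r).1 hr, map_zero, map_zero] at h2
    exact (hKmem r).1 (Ideal.Quotient.eq_zero_iff_mem.1 h2)
  · intro hr
    exact (hP.mem_or_mem (hI hr)).resolve_right fun h => hg ((hmem g).1 h)

theorem X_pow_dvd_of_mem_symbolicPower {I : Ideal (MvPolynomial (Fin 3) k)}
    {φ : MvPolynomial (Fin 3) k →ₐ[k] Polynomial (MvPolynomial (Fin 3) k)}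
    (hI : I ≤ (Ideal.span {Polynomial.X}).comap φ)
    (hP : (Ideal.span {Polynomial.X}).comap φ ∈
      associatedPrimes (MvPolynomial (Fin 3) k) (MvPolynomial (Fin 3) k ⧸ I)) {N : ℕ}
    {f : MvPolynomial (Fin 3) k} (hf : f ∈ symbolicPower I N) : Polynomial.X ^ N ∣ φ f := by
  obtain ⟨s, hs, hsf⟩ := hf _ hP
  have h1 := (Ideal.pow_right_mono hI N).trans (Ideal.le_comap_pow φ N) hsf
  rw [Ideal.span_singleton_pow, Ideal.mem_comap, Ideal.mem_span_singleton, map_mul] at h1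
  rw [Ideal.mem_comap, Ideal.mem_span_singleton] at hs
  exact Polynomial.prime_X.pow_dvd_of_dvd_mul_left N hs h1

theorem fermatIdeal_le_comap {n : ℕ}
    {φ : MvPolynomial (Fin 3) k →ₐ[k] Polynomial (MvPolynomial (Fin 3) k)}
    (hx : (φ (X 0 * (X 1 ^ n - X 2 ^ n))).eval 0 = 0)
    (hy : (φ (X 1 * (X 2 ^ n - X 0 ^ n))).eval 0 = 0)
    (hz : (φ (X 2 * (X 0 ^ n - X 1 ^ n))).eval 0 = 0) :
    fermatIdeal k n ≤ (Ideal.span {Polynomial.X}).comap φ := by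
  refine Ideal.span_le.2 ?_
  rintro _ (rfl | rfl | rfl) <;> rw [SetLike.mem_coe, Ideal.mem_comap, Ideal.mem_span_singleton,
    Polynomial.X_dvd_iff, Polynomial.coeff_zero_eq_eval_zero] <;> assumption

theorem eval_zero_pointHom_X (ζ : Fin 3 → k) (i : Fin 3) :
    (pointHom ζ (X i)).eval 0 = C (ζ i) * X 2 := by
  fin_cases i <;> simp [pointHom]

theorem fermatIdeal_le_comap_pointHom {n : ℕ} {ζ : Fin 3 → k} (hζ : ∀ i, ζ i ^ n = 1) :
    fermatIdeal k n ≤ (Ideal.span {Polynomial.X}).comap (pointHom ζ) := by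
  refine fermatIdeal_le_comap ?_ ?_ ?_ <;>
  simp only [map_mul, map_sub, map_pow, Polynomial.eval_mul, Polynomial.eval_sub,
    Polynomial.eval_pow, eval_zero_pointHom_X, mul_pow] <;>
  simp only [← map_pow, hζ] <;> simp

theorem fermatIdeal_le_comap_weightHom {n : ℕ} (hn : n ≠ 0) {w : Fin 3 → ℕ}
    (hw : w = ![1, 1, 0] ∨ w = ![0, 1, 1] ∨ w = ![1, 0, 1]) :
    fermatIdeal k n ≤ (Ideal.span {Polynomial.X}).comap (weightHom w) := by
  rcases hw with rfl | rfl | rfl <;>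
  refine fermatIdeal_le_comap ?_ ?_ ?_ <;> simp [weightHom, hn]

theorem eval_zero_weightHom_X (w : Fin 3 → ℕ) (i : Fin 3) :
    (weightHom (k := k) w (X i)).eval 0 = if w i = 0 then X i else 0 := by
  simp [weightHom, zero_pow_eq]

theorem comap_weightHom_mem_associatedPrimes {n : ℕ} (hn : n ≠ 0) {w : Fin 3 → ℕ}
    (hw : w = ![1, 1, 0] ∨ w = ![0, 1, 1] ∨ w = ![1, 0, 1]) :
    (Ideal.span {Polynomial.X}).comap (weightHom w) ∈
      associatedPrimes (MvPolynomial (Fin 3) k) (MvPolynomial (Fin 3) k ⧸ fermatIdeal k n) := by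
  have hle := fermatIdeal_le_comap_weightHom (k := k) hn hw
  have hx := X_zero_mul_mem_fermatIdeal (k := k) n
  have hy := X_one_mul_mem_fermatIdeal (k := k) n
  have hz := X_two_mul_mem_fermatIdeal (k := k) n
  rcases hw with rfl | rfl | rfl
  · refine comap_span_X_mem_associatedPrimes hle
      (g := (X 1 ^ n - X 2 ^ n) * (X 2 ^ n - X 0 ^ n)) ?_ (AlgHom.id k _) ?_
    · simp [eval_zero_weightHom_X, hn]
    · simp only [eval_zero_weightHom_X, AlgHom.id_apply]
      refine Fin.forall_fin_succ.2 ⟨?_, Fin.forall_fin_two.2 ⟨?_, ?_⟩⟩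
      · convert Ideal.mul_mem_right (X 2 ^ n - X 0 ^ n) _ hx using 1
        simp [mul_assoc]
      · convert Ideal.mul_mem_left _ (X 1 ^ n - X 2 ^ n) hy using 1
        simp [mul_left_comm]
      · simp
  · refine comap_span_X_mem_associatedPrimes hle
      (g := (X 2 ^ n - X 0 ^ n) * (X 0 ^ n - X 1 ^ n)) ?_ (AlgHom.id k _) ?_
    · simp [eval_zero_weightHom_X, hn]
    · simp only [eval_zero_weightHom_X, AlgHom.id_apply]
      refine Fin.forall_fin_succ.2 ⟨?_, Fin.forall_fin_two.2 ⟨?_, ?_⟩⟩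
      · simp
      · convert Ideal.mul_mem_right (X 0 ^ n - X 1 ^ n) _ hy using 1
        simp [mul_assoc]
      · convert Ideal.mul_mem_left _ (X 2 ^ n - X 0 ^ n) hz using 1
        simp [mul_left_comm]
  · refine comap_span_X_mem_associatedPrimes hle
      (g := (X 0 ^ n - X 1 ^ n) * (X 1 ^ n - X 2 ^ n)) ?_ (AlgHom.id k _) ?_
    · simp [eval_zero_weightHom_X, hn]
    · simp only [eval_zero_weightHom_X, AlgHom.id_apply]
      refine Fin.forall_fin_succ.2 ⟨?_, Fin.forall_fin_two.2 ⟨?_, ?_⟩⟩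
      · convert Ideal.mul_mem_left _ (X 0 ^ n - X 1 ^ n) hx using 1
        simp [mul_left_comm]
      · simp
      · convert Ideal.mul_mem_right (X 1 ^ n - X 2 ^ n) _ hz using 1
        simp [mul_assoc]

theorem comap_pointHom_mem_associatedPrimes {n : ℕ} (hn : (n : k) ≠ 0) {ζ : Fin 3 → k}
    (hζ : ∀ i, ζ i ^ n = 1) :
    (Ideal.span {Polynomial.X}).comap (pointHom ζ) ∈
      associatedPrimes (MvPolynomial (Fin 3) k) (MvPolynomial (Fin 3) k ⧸ fermatIdeal k n) := by
  have hn' : n ≠ 0 := by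
    rintro rfl
    simp at hn
  have hζ' : ∀ i, ζ i ≠ 0 := fun i h => by simpa [h, hn'] using hζ i
  let h : Fin 3 → MvPolynomial (Fin 3) k := fun j =>
    ∑ i ∈ Finset.range n, X j ^ i * (C (ζ j * (ζ 2)⁻¹) * X 2) ^ (n - 1 - i)
  have hh : ∀ j, h j * (X j - C (ζ j) * (C (ζ 2)⁻¹ * X 2)) = X j ^ n - X 2 ^ n := fun j => by
    rw [← mul_assoc, ← map_mul, geom_sum₂_mul, mul_pow, ← map_pow, mul_pow, inv_pow, hζ, hζ]
    simp
  have hev : ∀ j, (pointHom ζ (h j)).eval 0 = (n : MvPolynomial (Fin 3) k) *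
      (C (ζ j) * X 2) ^ (n - 1) := fun j => by
    rw [← geom_sum₂_self]
    have hC : (pointHom ζ (C (ζ j * (ζ 2)⁻¹) * X 2)).eval 0 = C (ζ j) * X 2 := by
      rw [map_mul, ← algebraMap_eq, AlgHom.commutes, Polynomial.algebraMap_apply,
        Polynomial.eval_mul, eval_zero_pointHom_X, Polynomial.eval_C, algebraMap_eq, ← mul_assoc,
        ← map_mul, mul_assoc, inv_mul_cancel₀ (hζ' 2), mul_one]
    rw [map_sum, Polynomial.eval_finsetSum]
    refine Finset.sum_congr rfl fun i _ => ?_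
    rw [map_mul, map_pow, map_pow, Polynomial.eval_mul, Polynomial.eval_pow, Polynomial.eval_pow,
      hC, eval_zero_pointHom_X]
  refine comap_span_X_mem_associatedPrimes (fermatIdeal_le_comap_pointHom hζ)
    (g := X 0 * X 1 * X 2 * h 0 * h 1) ?_ (aeval fun i => C (ζ 2)⁻¹ * X i) ?_
  · simp only [map_mul, Polynomial.eval_mul, hev, eval_zero_pointHom_X]
    have hn'' : (n : MvPolynomial (Fin 3) k) ≠ 0 := by
      rw [← map_natCast (C : k →+* MvPolynomial (Fin 3) k)]
      exact C_ne_zero.2 hn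
    have hC : ∀ i, (C (ζ i) : MvPolynomial (Fin 3) k) ≠ 0 := fun i => C_ne_zero.2 (hζ' i)
    simp [hn'', hζ']
  · intro i
    rw [eval_zero_pointHom_X, map_mul, aeval_X, ← algebraMap_eq, AlgHom.commutes, algebraMap_eq]
    fin_cases i
    · change (X 0 - C (ζ 0) * (C (ζ 2)⁻¹ * X 2)) * (X 0 * X 1 * X 2 * h 0 * h 1) ∈ fermatIdeal k n
      have := Ideal.mul_mem_left _ (-(X 0 * X 2 * h 1)) (X_one_mul_mem_fermatIdeal (k := k) n)
      convert this using 1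
      linear_combination (X 0 * X 1 * X 2 * h 1) * hh 0
    · change (X 1 - C (ζ 1) * (C (ζ 2)⁻¹ * X 2)) * (X 0 * X 1 * X 2 * h 0 * h 1) ∈ fermatIdeal k n
      have := Ideal.mul_mem_left _ (X 1 * X 2 * h 0) (X_zero_mul_mem_fermatIdeal (k := k) n)
      convert this using 1
      linear_combination (X 0 * X 1 * X 2 * h 0) * hh 1
    · convert zero_mem (fermatIdeal k n) using 1
      refine mul_eq_zero_of_left (sub_eq_zero_of_eq ?_) _
      change X 2 = C (ζ 2) * (C (ζ 2)⁻¹ * X 2)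
      rw [← mul_assoc, ← map_mul, mul_inv_cancel₀ (hζ' 2), map_one, one_mul]

theorem symbolicPower_fermatIdeal_le {n N : ℕ} {ω : k} (hω : IsPrimitiveRoot ω n) [NeZero n]
    (hn : (n : k) ≠ 0) : symbolicPower (fermatIdeal k n) N ≤ binomialIdeal k n N N N N := by
  intro f hf
  have hn' := NeZero.ne n
  have key : ∀ w : Fin 3 → ℕ, w = ![1, 1, 0] ∨ w = ![0, 1, 1] ∨ w = ![1, 0, 1] →
      Polynomial.X ^ N ∣ weightHom w f := fun w hw =>
    X_pow_dvd_of_mem_symbolicPower (fermatIdeal_le_comap_weightHom hn' hw)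
      (comap_weightHom_mem_associatedPrimes hn' hw) hf
  exact mem_binomialIdeal_of_dvd hω hn (fun ζ hζ => X_pow_dvd_of_mem_symbolicPower
    (fermatIdeal_le_comap_pointHom hζ) (comap_pointHom_mem_associatedPrimes hn hζ) hf)
    (key _ (by simp)) (key _ (by simp)) (key _ (by simp))

theorem pow_mul_mem_pow {A : Type*} [CommRing A] {I J : Ideal A} {s f : A}
    (h : Ideal.span {s} * J ≤ I) {N : ℕ} (hf : f ∈ J ^ N) : s ^ N * f ∈ I ^ N := by
  refine Ideal.pow_right_mono h N ?_
  rw [mul_pow, Ideal.span_singleton_pow]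
  exact Ideal.mul_mem_mul (Ideal.mem_span_singleton_self _) hf

theorem binomialIdeal_le_pow_span_binomials (n N : ℕ) :
    binomialIdeal k n N N N N ≤
      Ideal.span {X 0 ^ n - X 1 ^ n, X 1 ^ n - X 2 ^ n, X 2 ^ n - X 0 ^ n} ^ N := by
  refine binomialIdeal_le fun a b c d e f h => ?_
  set J : Ideal (MvPolynomial (Fin 3) k) :=
    Ideal.span {X 0 ^ n - X 1 ^ n, X 1 ^ n - X 2 ^ n, X 2 ^ n - X 0 ^ n}
  have hu : (X 0 ^ n - X 1 ^ n : MvPolynomial (Fin 3) k) ∈ J := Ideal.subset_span (by simp)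
  have hv : (X 1 ^ n - X 2 ^ n : MvPolynomial (Fin 3) k) ∈ J := Ideal.subset_span (by simp)
  have hw : (X 2 ^ n - X 0 ^ n : MvPolynomial (Fin 3) k) ∈ J := Ideal.subset_span (by simp)
  have h1 := Ideal.mul_mem_mul (Ideal.mul_mem_mul (Ideal.pow_mem_pow hu d)
    (Ideal.pow_mem_pow hv e)) (Ideal.pow_mem_pow hw f)
  rw [← pow_add, ← pow_add] at h1
  convert Ideal.mul_mem_left _ (X 0 ^ a * X 1 ^ b * X 2 ^ c) (Ideal.pow_le_pow_right h.1 h1) using 1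
  ring

theorem pow_mul_pow_mul_sub_pow_mem {A : Type*} [CommRing A] (x y : A) {n N a b d : ℕ}
    (h : N ≤ a + b + n * d) : x ^ a * y ^ b * (x ^ n - y ^ n) ^ d ∈ Ideal.span {x, y} ^ N := by
  have hx : x ∈ Ideal.span {x, y} := Ideal.subset_span (by simp)
  have hy : y ∈ Ideal.span {x, y} := Ideal.subset_span (by simp)
  have h1 := Ideal.mul_mem_mul (Ideal.mul_mem_mul (Ideal.pow_mem_pow hx a)
    (Ideal.pow_mem_pow hy b)) (Ideal.pow_mem_pow
      (sub_mem (Ideal.pow_mem_pow hx n) (Ideal.pow_mem_pow hy n)) d)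
  rw [← pow_add, ← pow_mul, ← pow_add] at h1
  exact Ideal.pow_le_pow_right h h1

theorem binomialIdeal_le_pow_span_pair (n N : ℕ) :
    binomialIdeal k n N N N N ≤ Ideal.span {X 0, X 1} ^ N ∧
    binomialIdeal k n N N N N ≤ Ideal.span {X 1, X 2} ^ N ∧
    binomialIdeal k n N N N N ≤ Ideal.span {X 2, X 0} ^ N := by
  refine ⟨binomialIdeal_le fun a b c d e f h => ?_, binomialIdeal_le fun a b c d e f h => ?_,
    binomialIdeal_le fun a b c d e f h => ?_⟩
  · convert Ideal.mul_mem_left _ (X 2 ^ c * (X 1 ^ n - X 2 ^ n) ^ e * (X 2 ^ n - X 0 ^ n) ^ f)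
      (pow_mul_pow_mul_sub_pow_mem (X 0 : MvPolynomial (Fin 3) k) (X 1) h.2.1) using 1
    ring
  · convert Ideal.mul_mem_left _ (X 0 ^ a * (X 0 ^ n - X 1 ^ n) ^ d * (X 2 ^ n - X 0 ^ n) ^ f)
      (pow_mul_pow_mul_sub_pow_mem (X 1 : MvPolynomial (Fin 3) k) (X 2) h.2.2.1) using 1
    ring
  · convert Ideal.mul_mem_left _ (X 1 ^ b * (X 0 ^ n - X 1 ^ n) ^ d * (X 1 ^ n - X 2 ^ n) ^ e)
      (pow_mul_pow_mul_sub_pow_mem (X 2 : MvPolynomial (Fin 3) k) (X 0)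
        ((add_comm c a).symm ▸ h.2.2.2)) using 1
    ring

theorem pow_sub_pow_notMem {A : Type*} [CommRing A] {P : Ideal A} [P.IsPrime] {x y : A} {n : ℕ}
    (hn : n ≠ 0) (h : (x ∈ P ∧ y ∉ P) ∨ (x ∉ P ∧ y ∈ P)) : x ^ n - y ^ n ∉ P := by
  intro h'
  rcases h with ⟨hx, hy⟩ | ⟨hx, hy⟩
  · refine hy (Ideal.IsPrime.mem_of_pow_mem ‹_› n ?_)
    exact (P.sub_mem_iff_right (P.pow_mem_of_mem hx n (Nat.pos_of_ne_zero hn))).1 h'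
  · refine hx (Ideal.IsPrime.mem_of_pow_mem ‹_› n ?_)
    exact (P.sub_mem_iff_left (P.pow_mem_of_mem hy n (Nat.pos_of_ne_zero hn))).1 h'

theorem mem_or_mem_of_mul_pow_sub_pow_mem {A : Type*} [CommRing A] {P : Ideal A} [P.IsPrime]
    {x y z : A} {n : ℕ} (hn : n ≠ 0) (h : y * (z ^ n - x ^ n) ∈ P) (hx : x ∈ P) : y ∈ P ∨ z ∈ P := by
  rcases Ideal.IsPrime.mem_or_mem ‹_› h with h | h
  · exact Or.inl h
  · by_contra! hz
    exact pow_sub_pow_notMem hn (Or.inr ⟨hz.2, hx⟩) h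

/-- The irrelevant ideal is not associated to the ideal of the Fermat arrangement. -/
theorem exists_X_notMem_of_mem_associatedPrimes {n : ℕ} {ω : k} (hω : IsPrimitiveRoot ω n)
    [NeZero n] (hn : (n : k) ≠ 0) {P : Ideal (MvPolynomial (Fin 3) k)}
    (hP : P ∈ associatedPrimes (MvPolynomial (Fin 3) k) (MvPolynomial (Fin 3) k ⧸ fermatIdeal k n)) :
    ∃ i, X i ∉ P := by
  by_contra! hX
  have hn' := NeZero.ne n
  obtain ⟨hprime, q, hq⟩ := hP
  obtain ⟨g, rfl⟩ := Ideal.Quotient.mk_surjective q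
  have hg : ∀ i, ∃ a, X i ^ a * g ∈ fermatIdeal k n := fun i => by
    have h1 := hX i
    rw [hq] at h1
    obtain ⟨a, ha⟩ := h1
    rw [Submodule.mem_colon_singleton, Submodule.mem_bot] at ha
    exact ⟨a, Ideal.Quotient.eq_zero_iff_mem.1 (by rw [map_mul]; exact ha)⟩
  have key : ∀ φ : MvPolynomial (Fin 3) k →ₐ[k] Polynomial (MvPolynomial (Fin 3) k),
      fermatIdeal k n ≤ (Ideal.span {Polynomial.X}).comap φ → ∀ i, (φ (X i)).eval 0 ≠ 0 →
      Polynomial.X ^ 1 ∣ φ g := fun φ hφ i hi => by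
    obtain ⟨a, ha⟩ := hg i
    have h1 := hφ ha
    rw [Ideal.mem_comap, Ideal.mem_span_singleton, map_mul, map_pow] at h1
    rw [pow_one]
    refine (Polynomial.prime_X.dvd_or_dvd h1).resolve_left fun h2 => hi ?_
    rw [← Polynomial.coeff_zero_eq_eval_zero, ← Polynomial.X_dvd_iff]
    exact Polynomial.prime_X.dvd_of_dvd_pow h2
  have hg' : g ∈ fermatIdeal k n := by
    refine binomialIdeal_one_le_fermatIdeal hn' (mem_binomialIdeal_of_dvd hω hn
      (fun ζ hζ => key _ (fermatIdeal_le_comap_pointHom hζ) 0 ?_)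
      (key _ (fermatIdeal_le_comap_weightHom hn' (by simp)) 2 ?_)
      (key _ (fermatIdeal_le_comap_weightHom hn' (by simp)) 0 ?_)
      (key _ (fermatIdeal_le_comap_weightHom hn' (by simp)) 1 ?_))
    · have h0 : ζ 0 ≠ 0 := fun h => by simpa [h, hn'] using hζ 0
      simp [eval_zero_pointHom_X, h0]
    all_goals simp [eval_zero_weightHom_X]
  refine hprime.ne_top (hq.trans ?_)
  rw [Ideal.Quotient.eq_zero_iff_mem.2 hg']
  simp

theorem Ideal.le_of_mem_associatedPrimes {A : Type*} [CommRing A] {I P : Ideal A}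
    (hP : P ∈ associatedPrimes A (A ⧸ I)) : I ≤ P := by
  obtain ⟨-, q, rfl⟩ := hP
  refine le_trans (fun i hi => ?_) Ideal.le_radical
  obtain ⟨g, rfl⟩ := Ideal.Quotient.mk_surjective q
  rw [Submodule.mem_colon_singleton, Submodule.mem_bot]
  exact Ideal.Quotient.eq_zero_iff_mem.2 (I.mul_mem_right g hi)

theorem binomialIdeal_le_symbolicPower {n N : ℕ} {ω : k} (hω : IsPrimitiveRoot ω n) [NeZero n]
    (hn : (n : k) ≠ 0) : binomialIdeal k n N N N N ≤ symbolicPower (fermatIdeal k n) N := by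
  intro F hF P hP
  have hn' := NeZero.ne n
  obtain ⟨hF₁, hF₂, hF₃⟩ := binomialIdeal_le_pow_span_pair (k := k) n N
  obtain ⟨i, hi⟩ := exists_X_notMem_of_mem_associatedPrimes hω hn hP
  have hle := Ideal.le_of_mem_associatedPrimes hP
  have hx := X_zero_mul_mem_fermatIdeal (k := k) n
  have hy := X_one_mul_mem_fermatIdeal (k := k) n
  have hz := X_two_mul_mem_fermatIdeal (k := k) n
  have hprime : P.IsPrime := hP.1
  suffices ∃ s, s ∉ P ∧ ∃ J : Ideal (MvPolynomial (Fin 3) k),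
      Ideal.span {s} * J ≤ fermatIdeal k n ∧ F ∈ J ^ N by
    obtain ⟨s, hs, J, hJ, hFJ⟩ := this
    exact ⟨s ^ N, fun h => hs (hprime.mem_of_pow_mem _ h), pow_mul_mem_pow hJ hFJ⟩
  have hxP := mem_or_mem_of_mul_pow_sub_pow_mem hn' (hle hy)
  have hyP := mem_or_mem_of_mul_pow_sub_pow_mem hn' (hle hz)
  have hzP := mem_or_mem_of_mul_pow_sub_pow_mem hn' (hle hx)
  have hcases : (X 0 ∉ P ∧ X 1 ∉ P ∧ X 2 ∉ P) ∨ (X 0 ∈ P ∧ X 1 ∈ P ∧ X 2 ∉ P) ∨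
      (X 0 ∉ P ∧ X 1 ∈ P ∧ X 2 ∈ P) ∨ (X 0 ∈ P ∧ X 1 ∉ P ∧ X 2 ∈ P) := by
    have hX : ¬ (X 0 ∈ P ∧ X 1 ∈ P ∧ X 2 ∈ P) := fun ⟨h0, h1, h2⟩ =>
      hi ((Fin.forall_fin_succ (P := fun j : Fin 3 => (X j : MvPolynomial (Fin 3) k) ∈ P)).2
        ⟨h0, Fin.forall_fin_two.2 ⟨h1, h2⟩⟩ i)
    clear hi hF hF₁ hF₂ hF₃ hx hy hz hle hP
    by_cases h0 : X 0 ∈ P <;> by_cases h1 : X 1 ∈ P <;> by_cases h2 : X 2 ∈ P <;>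
      simp only [h0, h1, h2, and_true, not_true_eq_false, not_false_eq_true,
        and_false, or_false, or_true, forall_const,
        false_implies] at hX hxP hyP hzP ⊢
  have hmul : ∀ {p q}, p ∉ P → q ∉ P → p * q ∉ P := fun hp hq h =>
    (hprime.mem_or_mem h).elim hp hq
  rcases hcases with ⟨h0, h1, h2⟩ | ⟨h0, h1, h2⟩ | ⟨h0, h1, h2⟩ | ⟨h0, h1, h2⟩
  · refine ⟨X 0 * X 1 * X 2, hmul (hmul h0 h1) h2, _, ?_, binomialIdeal_le_pow_span_binomials n N hF⟩
    rw [Ideal.span_mul_span', Ideal.span_le]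
    rintro _ ⟨_, rfl, _, (rfl | rfl | rfl), rfl⟩ <;> rw [SetLike.mem_coe]
    · convert Ideal.mul_mem_left _ (X 0 * X 1) hz using 1
      ring
    · convert Ideal.mul_mem_left _ (X 1 * X 2) hx using 1
      ring
    · convert Ideal.mul_mem_left _ (X 0 * X 2) hy using 1
      ring
  · refine ⟨(X 1 ^ n - X 2 ^ n) * (X 2 ^ n - X 0 ^ n), hmul (pow_sub_pow_notMem hn' (by tauto))
      (pow_sub_pow_notMem hn' (by tauto)), _, ?_, hF₁ hF⟩
    rw [Ideal.span_mul_span', Ideal.span_le]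
    rintro _ ⟨_, rfl, _, (rfl | rfl), rfl⟩ <;> rw [SetLike.mem_coe]
    · convert Ideal.mul_mem_left _ (X 2 ^ n - X 0 ^ n) hx using 1
      ring
    · convert Ideal.mul_mem_left _ (X 1 ^ n - X 2 ^ n) hy using 1
      ring
  · refine ⟨(X 2 ^ n - X 0 ^ n) * (X 0 ^ n - X 1 ^ n), hmul (pow_sub_pow_notMem hn' (by tauto))
      (pow_sub_pow_notMem hn' (by tauto)), _, ?_, hF₂ hF⟩
    rw [Ideal.span_mul_span', Ideal.span_le]
    rintro _ ⟨_, rfl, _, (rfl | rfl), rfl⟩ <;> rw [SetLike.mem_coe]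
    · convert Ideal.mul_mem_left _ (X 0 ^ n - X 1 ^ n) hy using 1
      ring
    · convert Ideal.mul_mem_left _ (X 2 ^ n - X 0 ^ n) hz using 1
      ring
  · refine ⟨(X 0 ^ n - X 1 ^ n) * (X 1 ^ n - X 2 ^ n), hmul (pow_sub_pow_notMem hn' (by tauto))
      (pow_sub_pow_notMem hn' (by tauto)), _, ?_, hF₃ hF⟩
    rw [Ideal.span_mul_span', Ideal.span_le]
    rintro _ ⟨_, rfl, _, (rfl | rfl), rfl⟩ <;> rw [SetLike.mem_coe]
    · convert Ideal.mul_mem_left _ (X 1 ^ n - X 2 ^ n) hz using 1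
      ring
    · convert Ideal.mul_mem_left _ (X 0 ^ n - X 1 ^ n) hx using 1
      ring

theorem symbolicPower_fermatIdeal_le_mul {n : ℕ} (hn3 : 3 ≤ n) {ω : k} (hω : IsPrimitiveRoot ω n)
    (hn : (n : k) ≠ 0) (r m : ℕ) :
    symbolicPower (fermatIdeal k n) (r * (m * n + 1)) ≤
      Ideal.span (Set.range X) ^ r * symbolicPower (fermatIdeal k n) (m * n) ^ r := by
  have : NeZero n := ⟨by omega⟩
  refine (symbolicPower_fermatIdeal_le hω hn).trans ?_
  rw [show r * (m * n + 1) = n * (m * r) + r by ring]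
  refine (binomialIdeal_add_le (NeZero.ne n) _ r).trans (Ideal.mul_mono_right ?_)
  refine (binomialIdeal_mul_le_pow hn3 _).trans ?_
  rw [pow_mul, mul_comm m n]
  exact Ideal.pow_right_mono
    ((binomialIdeal_pow_le n m).trans (binomialIdeal_le_symbolicPower hω hn)) r

theorem exists_isPrimitiveRoot_of_card_eq {n : ℕ} (hn : n ≠ 0) {S : Finset k} (hS : S.card = n)
    (h : ∀ ζ ∈ S, ζ ^ n = 1) : ∃ ω : k, IsPrimitiveRoot ω n := by
  have : NeZero n := ⟨hn⟩
  rw [← card_rootsOfUnity_eq_iff_exists_isPrimitiveRoot]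
  refine le_antisymm (card_rootsOfUnity k n) ?_
  let F : S → rootsOfUnity n k := fun ζ => rootsOfUnity.mkOfPowEq ζ.1 (h ζ.1 ζ.2)
  have hF : Function.Injective F := fun a b hab => Subtype.ext <| by
    have := congrArg (fun u : rootsOfUnity n k => ((u : kˣ) : k)) hab
    rwa [rootsOfUnity.coe_mkOfPowEq, rootsOfUnity.coe_mkOfPowEq] at this
  simpa [hS] using Nat.card_le_card_of_injective F hF

end FermatArrangement

/-- **Example `example fermat` (containment).** Let `k` be a field of characteristic `0`
containing `n` distinct `n`-th roots of unity, `n ≥ 3`, and let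
`I = (x(yⁿ−zⁿ), y(zⁿ−xⁿ), z(xⁿ−yⁿ)) ⊆ k[x,y,z]`.  Then for all `r, m ≥ 1`,
`I^{(r(mn+1))} ⊆ 𝔪^r (I^{(mn)})^r` where `𝔪 = (x,y,z)`. -/
theorem stmt_18 {k : Type*} [Field k] [CharZero k] (n : ℕ) (hn : 3 ≤ n)
    (hroots : ∃ S : Finset k, S.card = n ∧ ∀ ζ ∈ S, ζ ^ n = 1)
    (I : Ideal (MvPolynomial (Fin 3) k))
    (hI : I = Ideal.span
      {MvPolynomial.X 0 * ((MvPolynomial.X 1) ^ n - (MvPolynomial.X 2) ^ n),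
       MvPolynomial.X 1 * ((MvPolynomial.X 2) ^ n - (MvPolynomial.X 0) ^ n),
       MvPolynomial.X 2 * ((MvPolynomial.X 0) ^ n - (MvPolynomial.X 1) ^ n)}) :
    ∀ r m : ℕ, 1 ≤ r → 1 ≤ m →
      symbolicPower I (r * (m * n + 1)) ≤
        (Ideal.span (Set.range (MvPolynomial.X : Fin 3 → MvPolynomial (Fin 3) k))) ^ r *
          (symbolicPower I (m * n)) ^ r := by
  obtain ⟨S, hS, hroot⟩ := hroots
  obtain ⟨ω, hω⟩ := exists_isPrimitiveRoot_of_card_eq (by omega) hS hroot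
  intro r m _ _
  subst hI
  exact symbolicPower_fermatIdeal_le_mul hn hω (Nat.cast_ne_zero.2 (by omega)) r m
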